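/- Neumann problem regularity in Morrey spaces: if u, f, g_β are smooth on [0,1]ⁿ with Δu = f in (0,1)ⁿ, n^β ∂_β u = n^β g_β on ∂[0,1]ⁿ, and ∫_{[0,1]ⁿ} u = 0, then ‖u‖_{M^q_{2,2}([0,1]ⁿ)} ≤ C ‖f‖_{M^q_2([0,1]ⁿ)} + C ‖g‖_{M^q_{2,1}([0,1]ⁿ)} for 1 < q < ∞. -/

import Mathlib

open MeasureTheory Metric

noncomputable def morreyNorm (n : ℕ) (p q : ℝ) (Ω : Set (EuclideanSpace ℝ (Fin n)))
    (f : EuclideanSpace ℝ (Fin n) → ℝ) : ℝ :=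
  ⨆ x₀ : EuclideanSpace ℝ (Fin n), ⨆ r : Set.Ioc (0:ℝ) 1,
    (r : ℝ) ^ ((n : ℝ) * (1/p - 1/q)) *
      (∫ y in Metric.ball x₀ (r : ℝ) ∩ Ω, |f y| ^ q) ^ (1/q)

/-- The unit cube [0,1]ⁿ. -/
def unitCube (n : ℕ) : Set (EuclideanSpace ℝ (Fin n)) :=
  {x | ∀ i, x i ∈ Set.Icc (0:ℝ) 1}

/-- The open unit cube (0,1)ⁿ. -/
def openUnitCube (n : ℕ) : Set (EuclideanSpace ℝ (Fin n)) :=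
  {x | ∀ i, x i ∈ Set.Ioo (0:ℝ) 1}

/-- Standard basis vector. -/
noncomputable def stdVec (n : ℕ) (i : Fin n) : EuclideanSpace ℝ (Fin n) :=
  EuclideanSpace.single i (1:ℝ)

/-- Pointwise Laplacian. -/
noncomputable def lapl (n : ℕ) (u : EuclideanSpace ℝ (Fin n) → ℝ)
    (x : EuclideanSpace ℝ (Fin n)) : ℝ :=
  ∑ i, fderiv ℝ (fun y => fderiv ℝ u y (stdVec n i)) x (stdVec n i)

/-- The Morrey–Sobolev norm M^q_{2,2}. -/
noncomputable def morreySobolev2 (n : ℕ) (p : ℝ) (Ω : Set (EuclideanSpace ℝ (Fin n)))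
    (u : EuclideanSpace ℝ (Fin n) → ℝ) : ℝ :=
  morreyNorm n p 2 Ω u + morreyNorm n p 2 Ω (fun y => ‖fderiv ℝ u y‖)
    + morreyNorm n p 2 Ω (fun y => ‖iteratedFDeriv ℝ 2 u y‖)

section
open Filter Topology Set


abbrev EE (n : ℕ) := EuclideanSpace ℝ (Fin n)

lemma swap_limit {n : ℕ} {a b : EE n → ℝ} {A B : NNReal} (ha : LipschitzWith A a)
    (hb : LipschitzWith B b) (hs : HasCompactSupport a) (v w : EE n) :
    Tendsto (fun t : ℝ => ∫ x, (t⁻¹ • (a (x + t • v) - a x)) * (t⁻¹ • (b (x + t • w) - b x)))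
      (𝓝[>] 0) (𝓝 (∫ x, lineDeriv ℝ a x v * lineDeriv ℝ b x w)) := by
  let K := cthickening (‖v‖) (tsupport a)
  have K_compact : IsCompact K := IsCompact.cthickening hs
  have hq : ∀ {f : EE n → ℝ} {C : NNReal}, LipschitzWith C f → ∀ (t : ℝ), 0 < t → ∀ x v : EE n,
      ‖t⁻¹ • (f (x + t • v) - f x)‖ ≤ C * ‖v‖ := by
    intro f C hf t ht x v
    calc ‖t⁻¹ • (f (x + t • v) - f x)‖
      = (t⁻¹ * ‖f (x + t • v) - f x‖) := by simp [abs_of_pos ht]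
    _ ≤ (t⁻¹ * (C * ‖(x + t • v) - x‖)) := by
      gcongr; exact LipschitzWith.norm_sub_le hf (x + t • v) x
    _ = (C * ‖v‖) := by simp [field, norm_smul, abs_of_nonneg ht.le]
  have hm : ∀ {f : EE n → ℝ} {C : NNReal}, LipschitzWith C f → ∀ (t : ℝ) (v : EE n),
      AEStronglyMeasurable (fun x => t⁻¹ • (f (x + t • v) - f x)) volume := by
    intro f C hf t v
    have := hf.continuous
    exact Continuous.aestronglyMeasurable (by fun_prop)
  apply tendsto_integral_filter_of_dominated_convergence
      (K.indicator (fun x ↦ (A * ‖v‖) * (B * ‖w‖)))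
  · filter_upwards with t
    exact (hm ha t v).mul (hm hb t w)
  · filter_upwards [Ioc_mem_nhdsGT zero_lt_one] with t ht
    have t_pos : 0 < t := ht.1
    filter_upwards with x
    by_cases hx : x ∈ K
    · rw [indicator_of_mem hx, norm_mul]
      exact mul_le_mul (hq ha t t_pos x v) (hq hb t t_pos x w) (norm_nonneg _) (by positivity)
    · have A' : a x = 0 := by
        rw [← Function.notMem_support]
        contrapose hx
        exact self_subset_cthickening _ (subset_tsupport _ hx)
      have B' : a (x + t • v) = 0 := by
        rw [← Function.notMem_support]
        contrapose hx
        apply mem_cthickening_of_dist_le _ _ (‖v‖) (tsupport a) (subset_tsupport _ hx)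
        simp only [dist_eq_norm, sub_add_cancel_left, norm_neg, norm_smul, Real.norm_eq_abs,
          abs_of_nonneg t_pos.le]
        exact mul_le_of_le_one_left (norm_nonneg v) ht.2
      simp only [B', A', _root_.sub_self, smul_eq_mul, mul_zero, zero_mul, norm_zero]
      exact indicator_nonneg (fun y _hy ↦ by positivity) _
  · rw [integrable_indicator_iff K_compact.measurableSet]
    exact ContinuousOn.integrableOn_compact K_compact (by fun_prop)
  · filter_upwards [ha.ae_lineDifferentiableAt v, hb.ae_lineDifferentiableAt w] with x hx hy
    exact hx.hasLineDerivAt.tendsto_slope_zero_right.mul hy.hasLineDerivAt.tendsto_slope_zero_right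

lemma swap_exact {n : ℕ} {a b : EE n → ℝ} (ha : Continuous a)
    (hb : Continuous b) (hs : HasCompactSupport a) (v w : EE n) :
    ∫ x, (a (x + v) - a x) * (b (x + w) - b x) =
      ∫ x, (a (x - w) - a x) * (b (x - v) - b x) := by
  have hi : ∀ p q : EE n, Integrable (fun x => a (x + p) * b (x + q)) := by
    intro p q
    apply Continuous.integrable_of_hasCompactSupport (by fun_prop)
    apply HasCompactSupport.mul_right
    exact hs.comp_homeomorph (Homeomorph.addRight p)
  have e : ∀ p q p' q' : EE n, ∫ x, (a (x + p) - a (x + p')) * (b (x + q) - b (x + q')) =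
     (∫ x, a (x + p) * b (x + q)) - (∫ x, a (x + p) * b (x + q'))
     - (∫ x, a (x + p') * b (x + q)) + (∫ x, a (x + p') * b (x + q')) := by
    intro p q p' q'
    have h0 : ∀ x, (a (x + p) - a (x + p')) * (b (x + q) - b (x + q')) =
      (a (x + p) * b (x + q) - a (x + p) * b (x + q')) -
      (a (x + p') * b (x + q) - a (x + p') * b (x + q')) := by intro x; ring
    simp only [h0]
    rw [integral_sub, integral_sub (hi p q) (hi p q'), integral_sub (hi p' q) (hi p' q')]
    · ring
    · exact (hi p q).sub (hi p q')
    · exact (hi p' q).sub (hi p' q')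
  have t : ∀ c p q : EE n, ∫ x, a (x + p) * b (x + q) = ∫ x, a (x + (p + c)) * b (x + (q + c)) := by
    intro c p q
    rw [← integral_add_right_eq_self (fun x => a (x + p) * b (x + q)) c]
    simp only [add_assoc, add_comm c]
  have e1 := e v w 0 0
  have e2 := e (-w) (-v) 0 0
  simp only [add_zero, ← sub_eq_add_neg] at e1 e2
  rw [e1, e2]
  have t1 := t (v + w) (-w) (-v)
  have t2 := t w (-w) 0
  have t3 := t v 0 (-v)
  simp only [neg_add_cancel, add_zero, zero_add, ← sub_eq_add_neg] at t1 t2 t3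
  rw [t1, t2, t3]
  have : -w + (v + w) = v := by abel
  rw [this]
  have : -v + (v + w) = w := by abel
  rw [this]
  ring

lemma swap_deriv {n : ℕ} {a b : EE n → ℝ} {A B : NNReal} (ha : LipschitzWith A a)
    (hb : LipschitzWith B b) (hs : HasCompactSupport a) (v w : EE n) :
    ∫ x, lineDeriv ℝ a x v * lineDeriv ℝ b x w = ∫ x, lineDeriv ℝ a x w * lineDeriv ℝ b x v := by
  have h1 := swap_limit ha hb hs v w
  have h2 := swap_limit ha hb hs (-w) (-v)
  have : (∫ x, lineDeriv ℝ a x (-w) * lineDeriv ℝ b x (-v)) =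
    ∫ x, lineDeriv ℝ a x w * lineDeriv ℝ b x v := by
    simp only [lineDeriv_neg, neg_mul_neg]
  rw [this] at h2
  refine tendsto_nhds_unique h1 (h2.congr ?_)
  intro t
  have := swap_exact ha.continuous hb.continuous hs (t • v) (t • w)
  simp only [smul_eq_mul]
  have e : ∀ p q : ℝ, t⁻¹ * p * (t⁻¹ * q) = (t⁻¹ * t⁻¹) * (p * q) := by intros; ring
  simp only [e, integral_const_mul, smul_neg, ← sub_eq_add_neg]
  rw [this]


noncomputable def dd {n : ℕ} (k : Fin n) (f : EE n → ℝ) (x : EE n) : ℝ :=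
  lineDeriv ℝ f x (stdVec n k)

def BM {α : Type*} [MeasurableSpace α] (h : α → ℝ) : Prop :=
  Measurable h ∧ ∃ C, ∀ x, |h x| ≤ C

namespace BM
variable {α : Type*} [MeasurableSpace α] {f g : α → ℝ}

lemma add (hf : BM f) (hg : BM g) : BM (fun x => f x + g x) := by
  obtain ⟨A, hA⟩ := hf.2
  obtain ⟨B, hB⟩ := hg.2
  exact ⟨hf.1.add hg.1, A + B, fun x => (abs_add_le _ _).trans (add_le_add (hA x) (hB x))⟩

lemma mul (hf : BM f) (hg : BM g) : BM (fun x => f x * g x) := by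
  obtain ⟨A, hA⟩ := hf.2
  obtain ⟨B, hB⟩ := hg.2
  refine ⟨hf.1.mul hg.1, A * B, fun x => ?_⟩
  rw [abs_mul]
  exact mul_le_mul (hA x) (hB x) (abs_nonneg _) ((abs_nonneg _).trans (hA x))

lemma const (c : ℝ) : BM (fun _ : α => c) := ⟨measurable_const, |c|, fun _ => le_rfl⟩

lemma cmul (c : ℝ) (hf : BM f) : BM (fun x => c * f x) := (BM.const c).mul hf

lemma neg (hf : BM f) : BM (fun x => - f x) := by
  simpa using hf.cmul (-1)

lemma sub (hf : BM f) (hg : BM g) : BM (fun x => f x - g x) := by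
  simpa [sub_eq_add_neg] using hf.add hg.neg

lemma sq (hf : BM f) : BM (fun x => f x ^ 2) := by
  simpa [pow_two] using hf.mul hf

lemma sum {ι : Type*} (s : Finset ι) {f : ι → α → ℝ} (hf : ∀ i, BM (f i)) :
    BM (fun x => ∑ i ∈ s, f i x) := by
  classical
  induction s using Finset.induction_on with
  | empty => simpa using BM.const 0
  | insert a s ha ih =>
    simp only [Finset.sum_insert ha]
    exact (hf a).add ih

lemma comp {β : Type*} [MeasurableSpace β] {c : β → α} (hf : BM f) (hc : Measurable c) :
    BM (fun x => f (c x)) := by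
  obtain ⟨A, hA⟩ := hf.2
  exact ⟨hf.1.comp hc, A, fun x => hA _⟩

lemma integrable (hf : BM f) (μ : Measure α) [IsFiniteMeasure μ] : Integrable f μ := by
  obtain ⟨A, hA⟩ := hf.2
  exact Integrable.of_bound hf.1.aestronglyMeasurable A (Eventually.of_forall hA)

lemma integrableOn (hf : BM f) {μ : Measure α} {s : Set α} (hs : μ s ≠ ⊤) :
    IntegrableOn f s μ := by
  have : IsFiniteMeasure (μ.restrict s) := ⟨by simpa using hs.lt_top⟩
  exact hf.integrable _

lemma iball {n : ℕ} {f : EE n → ℝ} (hf : BM f) (x : EE n) (r : ℝ) :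
    IntegrableOn f (ball x r) := hf.integrableOn measure_ball_lt_top.ne

lemma integrable_zero {n : ℕ} {f : EE n → ℝ} (hf : BM f) (x : EE n) (r : ℝ)
    (h0 : ∀ y, y ∉ closedBall x r → f y = 0) : Integrable f := by
  have h1 : IntegrableOn f (closedBall x r) := hf.integrableOn measure_closedBall_lt_top.ne
  exact (integrableOn_iff_integrable_of_support_subset (fun y hy => by
    by_contra h; exact hy (h0 y h))).1 h1

end BM

lemma norm_stdVec {n : ℕ} (k : Fin n) : ‖stdVec n k‖ = 1 := by simp [stdVec]

lemma dd_bound {n : ℕ} {f : EE n → ℝ} {A : NNReal} (hf : LipschitzWith A f) (k : Fin n) (x : EE n) :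
    |dd k f x| ≤ A := by
  have := norm_lineDeriv_le_of_lipschitz ℝ hf (x₀ := x) (v := stdVec n k)
  simpa [dd, norm_stdVec] using this

lemma dd_BM {n : ℕ} {f : EE n → ℝ} {A : NNReal} (hf : LipschitzWith A f) (k : Fin n) :
    BM (dd k f) :=
  ⟨measurable_lineDeriv hf.continuous, A, dd_bound hf k⟩

lemma dd_mul {n : ℕ} {f g : EE n → ℝ} {A B : NNReal} (hf : LipschitzWith A f)
    (hg : LipschitzWith B g) (k : Fin n) :
    ∀ᵐ x, dd k (fun y => f y * g y) x = f x * dd k g x + dd k f x * g x := by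
  filter_upwards [hf.ae_lineDifferentiableAt (stdVec n k), hg.ae_lineDifferentiableAt (stdVec n k)]
    with x h1 h2
  have := HasDerivAt.mul h1.hasLineDerivAt h2.hasLineDerivAt
  simp only [zero_smul, add_zero] at this
  have h3 : HasLineDerivAt ℝ (fun y => f y * g y) (dd k f x * g x + f x * dd k g x) x (stdVec n k) := this
  rw [dd, h3.lineDeriv]; ring

lemma dd_sub {n : ℕ} {f g : EE n → ℝ} {A B : NNReal} (hf : LipschitzWith A f)
    (hg : LipschitzWith B g) (k : Fin n) :
    ∀ᵐ x, dd k (fun y => f y - g y) x = dd k f x - dd k g x := by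
  filter_upwards [hf.ae_lineDifferentiableAt (stdVec n k), hg.ae_lineDifferentiableAt (stdVec n k)]
    with x h1 h2
  have := HasDerivAt.sub h1.hasLineDerivAt h2.hasLineDerivAt
  have h3 : HasLineDerivAt ℝ (fun y => f y - g y) (dd k f x - dd k g x) x (stdVec n k) := this
  rw [dd, h3.lineDeriv]

lemma dd_congr {n : ℕ} {f g : EE n → ℝ} {x : EE n} (h : f =ᶠ[𝓝 x] g) (k : Fin n) :
    dd k f x = dd k g x := h.lineDeriv_eq

lemma dd_zero {n : ℕ} {f : EE n → ℝ} {x : EE n} {r : ℝ} (h : ∀ y, y ∉ closedBall x r → f y = 0)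
    (k : Fin n) : ∀ y, y ∉ closedBall x r → dd k f y = 0 := by
  intro y hy
  have : f =ᶠ[𝓝 y] (fun _ => (0:ℝ)) := by
    filter_upwards [isClosed_closedBall.isOpen_compl.mem_nhds hy] with z hz
    exact h z hz
  rw [dd_congr this]
  simp [dd, lineDeriv]

noncomputable def SS {n : ℕ} (w : Fin n → EE n → ℝ) (x : EE n) : ℝ :=
  ∑ i, ∑ j, (dd i (w j) x) ^ 2

noncomputable def GG {n : ℕ} (w : Fin n → EE n → ℝ) (x : EE n) : ℝ :=
  (∑ j, dd j (w j) x) ^ 2 + ∑ i, ∑ j, (dd i (w j) x - dd j (w i) x) ^ 2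

lemma SS_nonneg {n : ℕ} (w : Fin n → EE n → ℝ) (x : EE n) : 0 ≤ SS w x := by
  unfold SS; positivity

lemma GG_nonneg {n : ℕ} (w : Fin n → EE n → ℝ) (x : EE n) : 0 ≤ GG w x := by
  unfold GG; positivity

lemma SS_BM {n : ℕ} {w : Fin n → EE n → ℝ} {A : NNReal} (hw : ∀ j, LipschitzWith A (w j)) :
    BM (SS w) := BM.sum _ fun i => BM.sum _ fun j => (dd_BM (hw j) i).sq

lemma GG_BM {n : ℕ} {w : Fin n → EE n → ℝ} {A : NNReal} (hw : ∀ j, LipschitzWith A (w j)) :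
    BM (GG w) := (BM.sum _ fun j => (dd_BM (hw j) j)).sq.add
      (BM.sum _ fun i => BM.sum _ fun j => ((dd_BM (hw j) i).sub (dd_BM (hw i) j)).sq)

lemma divcurl {n : ℕ} {v : Fin n → EE n → ℝ} {A : NNReal} (hv : ∀ j, LipschitzWith A (v j))
    (x : EE n) (r : ℝ) (h0 : ∀ j, ∀ y, y ∉ closedBall x r → v j y = 0) :
    ∫ y, SS v y ≤ ∫ y, GG v y := by
  have hz : ∀ i j, ∀ y, y ∉ closedBall x r → dd i (v j) y = 0 := fun i j => dd_zero (h0 j) i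
  have hcs : ∀ j, HasCompactSupport (v j) := fun j =>
    HasCompactSupport.intro (isCompact_closedBall x r) (h0 j)
  have hI : ∀ i j k l, Integrable (fun y => dd i (v j) y * dd k (v l) y) := by
    intro i j k l
    apply BM.integrable_zero ((dd_BM (hv j) i).mul (dd_BM (hv l) k)) x r
    intro y hy
    simp [hz i j y hy]
  have hG : Integrable (GG v) := by
    apply BM.integrable_zero (GG_BM hv) x r
    intro y hy
    simp [GG, hz _ _ y hy]
  have hswap : ∫ y, (∑ i, ∑ j, dd i (v j) y * dd j (v i) y) =
      ∫ y, (∑ i, ∑ j, dd j (v j) y * dd i (v i) y) := by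
    rw [integral_finsetSum _ (fun i _ => integrable_finsetSum _ fun j _ => hI _ _ _ _),
      integral_finsetSum _ (fun i _ => integrable_finsetSum _ fun j _ => hI _ _ _ _)]
    refine Finset.sum_congr rfl fun i _ => ?_
    rw [integral_finsetSum _ (fun j _ => hI _ _ _ _),
      integral_finsetSum _ (fun j _ => hI _ _ _ _)]
    refine Finset.sum_congr rfl fun j _ => ?_
    exact swap_deriv (hv j) (hv i) (hcs j) _ _
  have hId : ∀ y, SS v y = (1/2) * (∑ i, ∑ j, (dd i (v j) y - dd j (v i) y) ^ 2)
      + ∑ i, ∑ j, dd i (v j) y * dd j (v i) y := by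
    intro y
    have e : ∑ i, ∑ j, (dd i (v j) y - dd j (v i) y) ^ 2 =
      (∑ i, ∑ j, (dd i (v j) y)^2) + (∑ i, ∑ j, (dd j (v i) y)^2)
        - 2 * ∑ i, ∑ j, dd i (v j) y * dd j (v i) y := by
      simp only [Finset.mul_sum, ← Finset.sum_add_distrib, ← Finset.sum_sub_distrib]
      refine Finset.sum_congr rfl fun i _ => Finset.sum_congr rfl fun j _ => ?_
      ring
    rw [e, Finset.sum_comm (f := fun i j => (dd j (v i) y)^2), SS]
    ring
  have hIc : Integrable (fun y => ∑ i, ∑ j, (dd i (v j) y - dd j (v i) y) ^ 2) := by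
    apply BM.integrable_zero
      (BM.sum _ fun i => BM.sum _ fun j => ((dd_BM (hv j) i).sub (dd_BM (hv i) j)).sq) x r
    intro y hy
    simp [hz _ _ y hy]
  have hIp : ∀ (a b c d : Fin n → Fin n → Fin n), Integrable (fun y => ∑ i, ∑ j,
      dd (a i j) (v (b i j)) y * dd (c i j) (v (d i j)) y) := fun a b c d =>
    integrable_finsetSum _ fun i _ => integrable_finsetSum _ fun j _ => hI _ _ _ _
  calc ∫ y, SS v y = (1/2) * (∫ y, ∑ i, ∑ j, (dd i (v j) y - dd j (v i) y) ^ 2)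
      + ∫ y, ∑ i, ∑ j, dd i (v j) y * dd j (v i) y := by
        rw [← integral_const_mul, ← integral_add (hIc.const_mul _)
          (hIp (fun i _ => i) (fun _ j => j) (fun _ j => j) (fun i _ => i))]
        simp only [hId]
    _ = ∫ y, ((1/2) * (∑ i, ∑ j, (dd i (v j) y - dd j (v i) y) ^ 2)
      + ∑ i, ∑ j, dd j (v j) y * dd i (v i) y) := by
        rw [hswap, ← integral_const_mul, ← integral_add (hIc.const_mul _)
          (hIp (fun _ j => j) (fun _ j => j) (fun i _ => i) (fun i _ => i))]
    _ ≤ ∫ y, GG v y := by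
        apply integral_mono _ hG
        · intro y
          have e : (∑ j, dd j (v j) y)^2 = ∑ i, ∑ j, dd j (v j) y * dd i (v i) y := by
            rw [pow_two, Finset.sum_mul_sum, Finset.sum_comm]
          have : 0 ≤ ∑ i, ∑ j, (dd i (v j) y - dd j (v i) y) ^ 2 := by positivity
          simp only [GG, e]
          linarith
        · exact (hIc.const_mul _).add (hIp (fun _ j => j) (fun _ j => j) (fun i _ => i) (fun i _ => i))


lemma lip_mul {n : ℕ} {f g : EE n → ℝ} {A B : NNReal} (hf : LipschitzWith A f)
    (hg : LipschitzWith B g) {a b : NNReal} (ha : ∀ x, |f x| ≤ a) (hb : ∀ x, |g x| ≤ b) :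
    LipschitzWith (a * B + b * A) (fun x => f x * g x) := by
  apply LipschitzWith.of_dist_le_mul
  intro x y
  have h1 := hf.dist_le_mul x y
  have h2 := hg.dist_le_mul x y
  rw [Real.dist_eq] at *
  have e : f x * g x - f y * g y = f x * (g x - g y) + (f x - f y) * g y := by ring
  rw [e]
  refine (abs_add_le _ _).trans ?_
  rw [abs_mul, abs_mul]
  have := mul_le_mul (ha x) h2 (abs_nonneg _) a.2
  have := mul_le_mul h1 (hb y) (abs_nonneg _) (by positivity)
  push_cast
  nlinarith

noncomputable def cut {n : ℕ} (x₀ : EE n) (r : ℝ) (y : EE n) : ℝ :=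
  max 0 (min 1 (2 - r⁻¹ * dist y x₀))

lemma cut_lip {n : ℕ} (x₀ : EE n) {r : NNReal} : LipschitzWith r⁻¹ (cut x₀ r) := by
  have h1 : LipschitzWith r⁻¹ (fun y : EE n => 2 - (r:ℝ)⁻¹ * dist y x₀) := by
    apply LipschitzWith.of_dist_le_mul
    intro x y
    rw [Real.dist_eq]
    have := abs_dist_sub_le x y x₀
    have e : 2 - (r:ℝ)⁻¹ * dist x x₀ - (2 - (r:ℝ)⁻¹ * dist y x₀) = - ((r:ℝ)⁻¹ * (dist x x₀ - dist y x₀)) := by ring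
    rw [e, abs_neg, abs_mul, abs_of_nonneg (by positivity), NNReal.coe_inv]
    gcongr
  exact (h1.const_min 1).const_max 0

lemma cut_nonneg {n : ℕ} (x₀ : EE n) (r : ℝ) (y) : 0 ≤ cut x₀ r y := le_max_left _ _
lemma cut_le {n : ℕ} (x₀ : EE n) (r : ℝ) (y) : cut x₀ r y ≤ 1 := by simp [cut]
lemma cut_one {n : ℕ} (x₀ : EE n) {r : ℝ} (hr : 0 < r) (y) (hy : y ∈ ball x₀ r) :
    cut x₀ r y = 1 := by
  have h : r⁻¹ * dist y x₀ ≤ 1 := by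
    rw [inv_mul_le_iff₀ hr]; simpa using (mem_ball.1 hy).le
  unfold cut
  rw [min_eq_left (by linarith), max_eq_right (by norm_num)]
lemma cut_zero {n : ℕ} (x₀ : EE n) {r : ℝ} (hr : 0 < r) (y) (hy : y ∉ closedBall x₀ (2 * r)) :
    cut x₀ r y = 0 := by
  have h : 2 ≤ r⁻¹ * dist y x₀ := by
    rw [mem_closedBall, not_le] at hy
    rw [le_inv_mul_iff₀ hr]; linarith
  unfold cut
  rw [max_eq_left]
  exact (min_le_right _ _).trans (by linarith)

lemma sum_sq_le {n : ℕ} (e : Fin n → ℝ) (w : Fin n → ℝ) (c : ℝ) (he : ∀ i, |e i| ≤ c) :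
    (∑ j, e j * w j) ^ 2 ≤ n * c ^ 2 * ∑ j, w j ^ 2 := by
  have h := Finset.sum_mul_sq_le_sq_mul_sq Finset.univ e w
  have h2 : ∑ i, e i ^ 2 ≤ n * c ^ 2 := by
    calc ∑ i, e i ^ 2 ≤ ∑ i : Fin n, c ^ 2 := Finset.sum_le_sum fun i _ => by
          rw [← sq_abs]; exact pow_le_pow_left₀ (abs_nonneg _) (he i) 2
      _ = n * c ^ 2 := by simp
  exact h.trans (mul_le_mul_of_nonneg_right h2 (by positivity))

lemma GG_pt {n : ℕ} (η c : ℝ) (e w : Fin n → ℝ) (p : Fin n → Fin n → ℝ) (h0 : 0 ≤ η) (h1 : η ≤ 1)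
    (he : ∀ i, |e i| ≤ c) :
    (∑ j, (η * p j j + e j * w j)) ^ 2 +
      ∑ i, ∑ j, ((η * p i j + e i * w j) - (η * p j i + e j * w i)) ^ 2 ≤
    2 * ((∑ j, p j j) ^ 2 + ∑ i, ∑ j, (p i j - p j i) ^ 2) + 10 * n * (c ^ 2 * ∑ j, w j ^ 2) := by
  have hη : η ^ 2 ≤ 1 := by nlinarith
  have hc : ∀ i, e i ^ 2 ≤ c ^ 2 := fun i => by
    rw [← sq_abs]; exact pow_le_pow_left₀ (abs_nonneg _) (he i) 2
  have A : (∑ j, (η * p j j + e j * w j)) ^ 2 ≤ 2 * (∑ j, p j j) ^ 2 + 2 * n * (c ^ 2 * ∑ j, w j ^ 2) := by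
    rw [Finset.sum_add_distrib, ← Finset.mul_sum]
    have := sum_sq_le e w c he
    set a := ∑ j, p j j
    set b := ∑ j, e j * w j
    have h3 : (η * a + b) ^ 2 ≤ 2 * (η ^ 2 * a ^ 2) + 2 * b ^ 2 := by nlinarith [sq_nonneg (η * a - b)]
    have h4 : η ^ 2 * a ^ 2 ≤ a ^ 2 := mul_le_of_le_one_left (sq_nonneg _) hη
    linarith
  have B : ∀ i j, ((η * p i j + e i * w j) - (η * p j i + e j * w i)) ^ 2 ≤
      2 * (p i j - p j i) ^ 2 + 4 * (c ^ 2 * w j ^ 2) + 4 * (c ^ 2 * w i ^ 2) := by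
    intro i j
    have h3 : ((η * p i j + e i * w j) - (η * p j i + e j * w i)) ^ 2 ≤
      2 * (η ^ 2 * (p i j - p j i) ^ 2) + 4 * (e i ^ 2 * w j ^ 2) + 4 * (e j ^ 2 * w i ^ 2) := by
      nlinarith [sq_nonneg (η * (p i j - p j i) - (e i * w j - e j * w i)), sq_nonneg (e i * w j + e j * w i)]
    have h4 : η ^ 2 * (p i j - p j i) ^ 2 ≤ (p i j - p j i) ^ 2 := mul_le_of_le_one_left (sq_nonneg _) hη
    have h5 := mul_le_mul_of_nonneg_right (hc i) (sq_nonneg (w j))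
    have h6 := mul_le_mul_of_nonneg_right (hc j) (sq_nonneg (w i))
    linarith
  have C : ∑ i, ∑ j, ((η * p i j + e i * w j) - (η * p j i + e j * w i)) ^ 2 ≤
      2 * (∑ i, ∑ j, (p i j - p j i) ^ 2) + 8 * n * (c ^ 2 * ∑ j, w j ^ 2) := by
    calc _ ≤ ∑ i, ∑ j, (2 * (p i j - p j i) ^ 2 + 4 * (c ^ 2 * w j ^ 2) + 4 * (c ^ 2 * w i ^ 2)) :=
          Finset.sum_le_sum fun i _ => Finset.sum_le_sum fun j _ => B i j
      _ = _ := by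
        simp only [Finset.sum_add_distrib, ← Finset.mul_sum, Finset.sum_const, Finset.card_univ,
          Fintype.card_fin, nsmul_eq_mul]
        ring
  linarith

lemma caccioppoli {n : ℕ} {w : Fin n → EE n → ℝ} {A B : NNReal} (hw : ∀ j, LipschitzWith A (w j))
    (hb : ∀ j x, |w j x| ≤ B) (x₀ : EE n) {r : ℝ} (hr : 0 < r) :
    ∫ y in ball x₀ r, SS w y ≤
      2 * (∫ y in ball x₀ (2 * r), GG w y)
        + 10 * n * (r⁻¹ ^ 2 * ∫ y in ball x₀ (2 * r), ∑ j, w j y ^ 2) := by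
  lift r to NNReal using hr.le
  set η := cut x₀ (r:ℝ) with hη
  have ηl : LipschitzWith r⁻¹ η := cut_lip x₀
  have ηb : ∀ x, |η x| ≤ (1 : NNReal) := fun x => by
    rw [abs_of_nonneg (cut_nonneg _ _ _)]; exact cut_le _ _ _
  set v : Fin n → EE n → ℝ := fun j y => η y * w j y with hv
  have vl : ∀ j, LipschitzWith (1 * A + B * r⁻¹) (v j) := fun j => lip_mul ηl (hw j) ηb (hb j)
  have v0 : ∀ j, ∀ y, y ∉ closedBall x₀ (2 * (r:ℝ)) → v j y = 0 := fun j y hy => by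
    simp [hv, hη, cut_zero x₀ hr y hy]
  have key := divcurl vl x₀ _ v0
  have wBM : ∀ j, BM (w j) := fun j => ⟨(hw j).continuous.measurable, B, hb j⟩
  have wsBM : BM (fun y => ∑ j, w j y ^ 2) := BM.sum _ fun j => (wBM j).sq
  have hIS : Integrable (SS v) := by
    apply BM.integrable_zero (SS_BM vl) x₀ (2 * r)
    intro y hy
    simp [SS, dd_zero (v0 _) _ y hy]
  have hIG : Integrable (GG v) := by
    apply BM.integrable_zero (GG_BM vl) x₀ (2 * r)
    intro y hy
    simp [GG, dd_zero (v0 _) _ y hy]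
  have h1 : ∫ y in ball x₀ (r:ℝ), SS w y = ∫ y in ball x₀ (r:ℝ), SS v y := by
    apply setIntegral_congr_fun measurableSet_ball
    intro y hy
    have : ∀ j, w j =ᶠ[𝓝 y] v j := fun j => by
      filter_upwards [isOpen_ball.mem_nhds hy] with z hz
      simp [hv, hη, cut_one x₀ hr z hz]
    simp only [SS, dd_congr (this _)]
  have h2 : ∫ y in ball x₀ (r:ℝ), SS v y ≤ ∫ y, SS v y :=
    setIntegral_le_integral hIS (Eventually.of_forall (SS_nonneg v))
  have h3 : ∫ y, GG v y ≤ ∫ y in ball x₀ (2 * (r:ℝ)), (2 * GG w y + 10 * n * ((r:ℝ)⁻¹ ^ 2 * ∑ j, w j y ^ 2)) := by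
    rw [← integral_indicator measurableSet_ball]
    apply integral_mono_ae hIG
    · rw [integrable_indicator_iff measurableSet_ball]
      exact (((GG_BM hw).cmul 2).add ((wsBM.cmul _).cmul _)).iball _ _
    · have hmul : ∀ᵐ x, ∀ i j, dd i (v j) x = η x * dd i (w j) x + dd i η x * w j x := by
        rw [ae_all_iff]; intro i; rw [ae_all_iff]; intro j
        exact dd_mul ηl (hw j) i
      have hsph : ∀ᵐ x, x ∉ sphere x₀ (2 * (r:ℝ)) :=
        measure_eq_zero_iff_ae_notMem.1 (Measure.addHaar_sphere_of_ne_zero volume x₀ (by positivity))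
      filter_upwards [hmul, hsph] with y hy hs
      by_cases hy2 : y ∈ ball x₀ (2 * (r:ℝ))
      · rw [indicator_of_mem hy2]
        have := GG_pt (η y) ((r:ℝ)⁻¹) (fun i => dd i η y) (fun j => w j y) (fun i j => dd i (w j) y)
          (cut_nonneg _ _ _) (cut_le _ _ _) (fun i => by simpa using dd_bound ηl i y)
        simp only [GG, hy]
        exact this
      · rw [indicator_of_notMem hy2]
        have : y ∉ closedBall x₀ (2 * (r:ℝ)) := by
          rw [← ball_union_sphere]; simp only [mem_union, not_or]; exact ⟨hy2, hs⟩
        simp [GG, dd_zero (v0 _) _ y this]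
  rw [integral_add (((GG_BM hw).cmul 2).iball _ _) (((wsBM.cmul _).cmul _).iball _ _),
    integral_const_mul, integral_const_mul, integral_const_mul] at h3
  linarith


lemma jensen_sq {α : Type*} [MeasurableSpace α] (ν : Measure α) [IsProbabilityMeasure ν]
    {h : α → ℝ} (hh : BM h) : (∫ y, h y ∂ν) ^ 2 ≤ ∫ y, h y ^ 2 ∂ν := by
  set m := ∫ y, h y ∂ν with hm
  have h0 : 0 ≤ ∫ y, (h y - m) ^ 2 ∂ν := integral_nonneg fun y => sq_nonneg _
  have e : ∀ y, (h y - m) ^ 2 = h y ^ 2 - (2 * m) * h y + m ^ 2 := fun y => by ring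
  simp only [e] at h0
  rw [integral_add ((hh.sq.sub (hh.cmul _)).integrable ν) ((BM.const _).integrable ν),
    integral_sub (hh.sq.integrable ν) ((hh.cmul _).integrable ν), integral_const_mul] at h0
  simp only [integral_const, probReal_univ, one_smul, ← hm] at h0
  nlinarith

lemma avg_trans {n : ℕ} {α : Type*} [MeasurableSpace α] (ν : Measure α) [IsProbabilityMeasure ν]
    (c : α → EE n) (hc : Measurable c) {h : EE n → ℝ} (hh : BM h) {A ρ : ℝ}
    (hA : ∀ z, ∫ x in ball z ρ, h x ≤ A) (x₀ : EE n) :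
    ∫ x in ball x₀ ρ, ∫ y, h (x + c y) ∂ν ≤ A := by
  have hfin : IsFiniteMeasure (volume.restrict (ball x₀ ρ)) := ⟨by simpa using measure_ball_lt_top⟩
  rw [integral_integral_swap]
  · have : ∀ y, ∫ x in ball x₀ ρ, h (x + c y) ≤ A := by
      intro y
      refine le_trans (le_of_eq ?_) (hA (x₀ + c y))
      have e : ball x₀ ρ = (fun x => x + c y) ⁻¹' (ball (x₀ + c y) ρ) := by
        ext x; simp [dist_eq_norm]
      rw [e]
      exact (measurePreserving_add_right volume (c y)).setIntegral_preimage_emb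
        (MeasurableEquiv.addRight (c y)).measurableEmbedding _ _
    calc _ ≤ ∫ y, A ∂ν := by
          apply integral_mono_ae
          · have : BM (fun p : α × EE n => h (p.2 + c p.1)) := hh.comp (by fun_prop)
            exact (this.integrable (ν.prod (volume.restrict (ball x₀ ρ)))).integral_prod_left
          · exact integrable_const _
          · exact Eventually.of_forall this
      _ = A := by simp
  · have : BM (fun p : EE n × α => h (p.1 + c p.2)) := hh.comp (by fun_prop)
    exact this.integrable _

lemma sum_stdVec {n : ℕ} (y : EE n) : y = ∑ k, y k • stdVec n k := by
  ext i
  simp [stdVec, Finset.sum_apply, Pi.single_apply]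

lemma lineDeriv_sq_le {n : ℕ} {F : EE n → ℝ} {A : NNReal} (hF : LipschitzWith A F) (y : EE n) :
    ∀ᵐ z, (lineDeriv ℝ F z y) ^ 2 ≤ ‖y‖ ^ 2 * ∑ k, dd k F z ^ 2 := by
  filter_upwards [hF.ae_differentiableAt] with z hz
  have h1 : lineDeriv ℝ F z y = ∑ k, y k * dd k F z := by
    rw [hz.lineDeriv_eq_fderiv]
    conv_lhs => rw [sum_stdVec y]
    simp [dd, hz.lineDeriv_eq_fderiv]
  rw [h1, EuclideanSpace.real_norm_sq_eq]
  exact Finset.sum_mul_sq_le_sq_mul_sq _ _ _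

lemma ftc_line {n : ℕ} {F : EE n → ℝ} {A : NNReal} (hF : LipschitzWith A F) (x y : EE n) :
    F (x + y) - F x = ∫ t in Ioc (0:ℝ) 1, lineDeriv ℝ F (x + t • y) y := by
  have h1 : LipschitzWith (A * ‖y‖₊) (fun t : ℝ => F (x + t • y)) := by
    apply hF.comp
    apply LipschitzWith.of_dist_le_mul
    intro s t
    simp only [dist_eq_norm, add_sub_add_left_eq_sub, ← sub_smul, norm_smul]
    simp [mul_comm]
  have h2 := (h1.lipschitzOnWith (s := uIcc (0:ℝ) 1)).absolutelyContinuousOnInterval.integral_deriv_eq_sub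
  simp only [one_smul, zero_smul, add_zero] at h2
  rw [← h2, intervalIntegral.integral_of_le zero_le_one]
  congr 1
  ext t
  unfold lineDeriv
  have e : (fun s : ℝ => F (x + t • y + s • y)) = fun s => (fun t : ℝ => F (x + t • y)) (t + s) := by
    ext s; simp [add_smul, add_assoc]
  rw [e]
  refine Eq.trans ?_ (deriv_comp_const_add (fun t : ℝ => F (x + t • y)) t 0).symm
  simp

instance prob01 : IsProbabilityMeasure (volume.restrict (Ioc (0:ℝ) 1)) := ⟨by simp⟩

lemma BM_of_lip {n : ℕ} {F : EE n → ℝ} {A : NNReal} {B : ℝ} (hF : LipschitzWith A F)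
    (hb : ∀ x, |F x| ≤ B) : BM F := ⟨hF.continuous.measurable, B, hb⟩

lemma diff_trans {n : ℕ} {F : EE n → ℝ} {A : NNReal} {B : ℝ} (hF : LipschitzWith A F)
    (hb : ∀ x, |F x| ≤ B) {K ρ : ℝ}
    (hK : ∀ z, ∫ x in ball z ρ, ∑ k, dd k F x ^ 2 ≤ K) (x₀ y : EE n) :
    ∫ x in ball x₀ ρ, (F (x + y) - F x) ^ 2 ≤ ‖y‖ ^ 2 * K := by
  have hBM := BM_of_lip hF hb
  have hl : BM (fun z => lineDeriv ℝ F z y) := ⟨measurable_lineDeriv hF.continuous, A * ‖y‖, fun z => by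
    simpa using norm_lineDeriv_le_of_lipschitz ℝ hF (x₀ := z) (v := y)⟩
  have hK2 : ∀ z, ∫ x in ball z ρ, (lineDeriv ℝ F x y) ^ 2 ≤ ‖y‖ ^ 2 * K := by
    intro z
    calc _ ≤ ∫ x in ball z ρ, ‖y‖ ^ 2 * ∑ k, dd k F x ^ 2 := by
          apply integral_mono_ae (hl.sq.iball _ _)
            (((BM.sum _ fun k => (dd_BM hF k).sq).cmul _).iball _ _)
          exact ae_restrict_of_ae (lineDeriv_sq_le hF y)
      _ ≤ _ := by rw [integral_const_mul]; exact mul_le_mul_of_nonneg_left (hK z) (by positivity)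
  refine le_trans ?_ (avg_trans (volume.restrict (Ioc (0:ℝ) 1)) (fun t => t • y) (by fun_prop)
    hl.sq hK2 x₀)
  have hfin : IsFiniteMeasure (volume.restrict (ball x₀ ρ)) := ⟨by simpa using measure_ball_lt_top⟩
  apply integral_mono ((((hBM.comp (measurable_add_const y)).sub hBM).sq).iball _ _)
  · have : BM (fun p : EE n × ℝ => (lineDeriv ℝ F (p.1 + p.2 • y) y) ^ 2) := hl.sq.comp (c := fun p : EE n × ℝ => p.1 + p.2 • y) (by fun_prop)
    exact (this.integrable ((volume.restrict (ball x₀ ρ)).prod (volume.restrict (Ioc (0:ℝ) 1)))).integral_prod_left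
  · intro x
    simp only
    rw [ftc_line hF x y]
    exact jensen_sq _ (hl.comp (by fun_prop))

noncomputable def nu (n : ℕ) (s : ℝ) : Measure (EE n) := ProbabilityTheory.cond volume (ball 0 s)

lemma nu_prob {n : ℕ} {s : ℝ} (hs : 0 < s) : IsProbabilityMeasure (nu n s) :=
  ProbabilityTheory.cond_isProbabilityMeasure_of_finite (measure_ball_pos _ _ hs).ne'
    measure_ball_lt_top.ne

lemma nu_ac {n : ℕ} {s : ℝ} : nu n s ≪ volume := ProbabilityTheory.cond_absolutelyContinuous

lemma nu_ball {n : ℕ} {s : ℝ} : ∀ᵐ y ∂(nu n s), y ∈ ball (0 : EE n) s :=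
  ProbabilityTheory.ae_cond_mem measurableSet_ball

noncomputable def avg {n : ℕ} (s : ℝ) (F : EE n → ℝ) (x : EE n) : ℝ := ∫ y, F (x + y) ∂(nu n s)

lemma avg_BM {n : ℕ} {s : ℝ} (hs : 0 < s) {F : EE n → ℝ} (hF : BM F) : BM (avg s F) := by
  have := nu_prob (n := n) hs
  obtain ⟨B, hB⟩ := hF.2
  refine ⟨?_, B, fun x => ?_⟩
  · have : Measurable (fun p : EE n × EE n => F (p.1 + p.2)) := hF.1.comp (by fun_prop)
    exact this.stronglyMeasurable.integral_prod_right.measurable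
  · have := norm_integral_le_of_norm_le_const (μ := nu n s) (f := fun y => F (x + y)) (C := B)
      (Eventually.of_forall fun y => hB _)
    simpa [avg] using this

lemma avg_lip {n : ℕ} {s : ℝ} (hs : 0 < s) {F : EE n → ℝ} {A : NNReal} {B : ℝ}
    (hF : LipschitzWith A F) (hb : ∀ x, |F x| ≤ B) : LipschitzWith A (avg s F) := by
  have := nu_prob (n := n) hs
  have hBM := BM_of_lip hF hb
  apply LipschitzWith.of_dist_le_mul
  intro x y
  rw [dist_eq_norm, avg, avg, ← integral_sub ((hBM.comp (measurable_const_add x)).integrable _)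
    ((hBM.comp (measurable_const_add y)).integrable _)]
  have := norm_integral_le_of_norm_le_const (μ := nu n s) (f := fun z => F (x + z) - F (y + z))
    (C := A * dist x y) (Eventually.of_forall fun z => by
      have := hF.dist_le_mul (x + z) (y + z)
      simpa [dist_eq_norm] using this)
  simpa using this

lemma avg_dd {n : ℕ} {s : ℝ} (hs : 0 < s) {F : EE n → ℝ} {A : NNReal} {B : ℝ}
    (hF : LipschitzWith A F) (hb : ∀ x, |F x| ≤ B) (k : Fin n) (x : EE n) :
    dd k (avg s F) x = avg s (dd k F) x := by
  have := nu_prob (n := n) hs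
  have hBM := BM_of_lip hF hb
  have key := hasDerivAt_integral_of_dominated_loc_of_lip (μ := nu n s) (s := univ) (x₀ := (0:ℝ))
    (F := fun t y => F (x + t • stdVec n k + y)) (F' := fun y => dd k F (x + y))
    (bound := fun _ => (A : ℝ)) univ_mem
    (Eventually.of_forall fun t => (hBM.comp (measurable_const_add _)).1.aestronglyMeasurable)
    ((hBM.comp (measurable_const_add _)).integrable _)
    ((dd_BM hF k).comp (measurable_const_add _)).1.aestronglyMeasurable
    (Eventually.of_forall fun y => by
      apply LipschitzWith.lipschitzOnWith
      apply LipschitzWith.of_dist_le_mul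
      intro t t'
      refine (hF.dist_le_mul _ _).trans ?_
      simp only [dist_eq_norm, add_sub_add_right_eq_sub, add_sub_add_left_eq_sub, ← sub_smul, norm_smul, norm_stdVec]
      simp)
    (integrable_const _)
    (by
      apply nu_ac.ae_le
      have h1 := hF.ae_lineDifferentiableAt (μ := volume) (stdVec n k)
      have h2 := (measurePreserving_add_left (volume : Measure (EE n)) x).quasiMeasurePreserving.ae h1
      filter_upwards [h2] with y hy
      have := hy.hasLineDerivAt
      unfold HasLineDerivAt at this
      refine this.congr_of_eventuallyEq (Eventually.of_forall fun t => ?_)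
      simp only
      congr 1; abel)
  have h3 : HasLineDerivAt ℝ (avg s F) (avg s (dd k F) x) x (stdVec n k) := key.2
  exact h3.lineDeriv

lemma avg_diff {n : ℕ} {s : ℝ} (hs : 0 < s) {F : EE n → ℝ} {A : NNReal} {B : ℝ}
    (hF : LipschitzWith A F) (hb : ∀ x, |F x| ≤ B) {K ρ : ℝ} (hK0 : 0 ≤ K)
    (hK : ∀ z, ∫ x in ball z ρ, ∑ k, dd k F x ^ 2 ≤ K) (x₀ : EE n) :
    ∫ x in ball x₀ ρ, (F x - avg s F x) ^ 2 ≤ s ^ 2 * K := by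
  have := nu_prob (n := n) hs
  have hBM := BM_of_lip hF hb
  have hfin : IsFiniteMeasure (volume.restrict (ball x₀ ρ)) := ⟨by simpa using measure_ball_lt_top⟩
  have hp : BM (fun p : EE n × EE n => (F (p.1 + p.2) - F p.1) ^ 2) :=
    ((hBM.comp (c := fun p : EE n × EE n => p.1 + p.2) (by fun_prop)).sub (hBM.comp measurable_fst)).sq
  calc ∫ x in ball x₀ ρ, (F x - avg s F x) ^ 2
      ≤ ∫ x in ball x₀ ρ, ∫ y, (F (x + y) - F x) ^ 2 ∂(nu n s) := by
        apply integral_mono ((hBM.sub (avg_BM hs hBM)).sq.iball _ _)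
        · exact (hp.integrable ((volume.restrict (ball x₀ ρ)).prod (nu n s))).integral_prod_left
        · intro x
          have h1 := jensen_sq (nu n s) ((hBM.comp (measurable_const_add x)).sub (BM.const (F x)))
          rw [integral_sub ((hBM.comp (measurable_const_add x)).integrable _) (integrable_const _)] at h1
          simp only [integral_const, probReal_univ, one_smul] at h1
          refine le_trans (le_of_eq ?_) h1
          simp only [avg]; ring
    _ = ∫ y, (∫ x in ball x₀ ρ, (F (x + y) - F x) ^ 2) ∂(nu n s) := by
        rw [integral_integral_swap]
        exact hp.integrable _
    _ ≤ ∫ y, s ^ 2 * K ∂(nu n s) := by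
        apply integral_mono_ae
        · have : BM (fun p : EE n × EE n => (F (p.2 + p.1) - F p.2) ^ 2) := hp.comp measurable_swap
          exact (this.integrable ((nu n s).prod (volume.restrict (ball x₀ ρ)))).integral_prod_left
        · exact integrable_const _
        · filter_upwards [nu_ball] with y hy
          refine (diff_trans hF hb hK x₀ y).trans ?_
          rw [mem_ball_zero_iff] at hy
          gcongr
    _ = _ := by simp


noncomputable def om (n : ℕ) : ℝ := volume.real (ball (0 : EE n) 1)

lemma om_pos (n : ℕ) : 0 < om n := by
  unfold om
  exact ENNReal.toReal_pos (measure_ball_pos _ _ one_pos).ne' measure_ball_lt_top.ne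

lemma vol_ball {n : ℕ} (x : EE n) {s : ℝ} (hs : 0 < s) : volume.real (ball x s) = s ^ n * om n := by
  unfold om Measure.real
  rw [Measure.addHaar_ball_of_pos _ _ hs]
  simp [ENNReal.toReal_mul, ENNReal.toReal_ofReal (pow_nonneg hs.le _), abs_of_pos hs]

lemma avg_eq {n : ℕ} {s : ℝ} (hs : 0 < s) (h : EE n → ℝ) (x : EE n) :
    avg s h x = (s ^ n * om n)⁻¹ * ∫ y in ball 0 s, h (x + y) := by
  unfold avg nu ProbabilityTheory.cond
  rw [integral_smul_measure, ← vol_ball (0 : EE n) hs]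
  simp [Measure.real]

noncomputable def pp (n : ℕ) (s t : ℝ) : ℝ := ((max s (min t (2 * s))) ^ n)⁻¹ - ((2 * s) ^ n)⁻¹

noncomputable def VV {n : ℕ} (s : ℝ) (i : Fin n) (y : EE n) : ℝ := y i * pp n s ‖y‖

lemma pp_lip (n : ℕ) {s : ℝ} (hs : 0 < s) : ∃ A, LipschitzWith A (pp n s) := by
  have h1 : ContDiffOn ℝ 1 (fun t : ℝ => (t ^ n)⁻¹) (Icc s (2 * s)) := by
    apply ContDiffOn.inv (by fun_prop)
    intro x hx
    have : 0 < x := lt_of_lt_of_le hs hx.1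
    positivity
  obtain ⟨A, hA⟩ := h1.exists_lipschitzOnWith one_ne_zero (convex_Icc _ _) isCompact_Icc
  refine ⟨A, LipschitzWith.of_dist_le_mul fun x y => ?_⟩
  have hm : ∀ x, max s (min x (2 * s)) ∈ Icc s (2 * s) := fun x =>
    ⟨le_max_left _ _, max_le (by linarith) (min_le_right _ _)⟩
  have h2 := hA.dist_le_mul _ (hm x) _ (hm y)
  have h3 : LipschitzWith 1 (fun x : ℝ => max s (min x (2 * s))) := (LipschitzWith.id.min_const _).const_max _
  have h4 := h3.dist_le_mul x y
  simp only [NNReal.coe_one, one_mul] at h4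
  simp only [pp, dist_sub_right]
  exact h2.trans (mul_le_mul_of_nonneg_left h4 A.2)

lemma pp_far (n : ℕ) {s t : ℝ} (hs : 0 < s) (ht : 2 * s ≤ t) : pp n s t = 0 := by
  unfold pp
  rw [min_eq_right ht, max_eq_right (by linarith), sub_self]

lemma pp_bd (n : ℕ) {s : ℝ} (hs : 0 < s) (t : ℝ) : |pp n s t| ≤ (s ^ n)⁻¹ := by
  have h1 : s ≤ max s (min t (2 * s)) := le_max_left _ _
  have h2 : max s (min t (2 * s)) ≤ 2 * s := max_le (by linarith) (min_le_right _ _)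
  have h0 : 0 < max s (min t (2 * s)) := hs.trans_le h1
  unfold pp
  have h3 : ((2 * s) ^ n)⁻¹ ≤ (max s (min t (2 * s)) ^ n)⁻¹ := by gcongr
  have h4 : (max s (min t (2 * s)) ^ n)⁻¹ ≤ (s ^ n)⁻¹ := by gcongr
  have h5 : 0 ≤ ((2 * s) ^ n)⁻¹ := by positivity
  rw [abs_of_nonneg (by linarith)]
  linarith

lemma VV_zero {n : ℕ} {s : ℝ} (hs : 0 < s) (i : Fin n) (y : EE n) (hy : y ∉ closedBall 0 (2 * s)) :
    VV s i y = 0 := by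
  rw [mem_closedBall_zero_iff, not_le] at hy
  simp [VV, pp_far n hs hy.le]

lemma VV_lip {n : ℕ} {s : ℝ} (hs : 0 < s) : ∃ A, ∀ i : Fin n, LipschitzWith A (VV s i) := by
  obtain ⟨A, hA⟩ := pp_lip n hs
  refine ⟨A * (2 * s).toNNReal + ((s ^ n)⁻¹).toNNReal, fun i => ?_⟩
  have key : ∀ y z : EE n, ‖y‖ ≤ 2 * s → |VV s i y - VV s i z| ≤ (A * (2 * s) + (s ^ n)⁻¹) * dist y z := by
    intro y z hy
    have e : VV s i y - VV s i z = y i * (pp n s ‖y‖ - pp n s ‖z‖) + (y i - z i) * pp n s ‖z‖ := by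
      simp only [VV]; ring
    have h1 := hA.dist_le_mul ‖y‖ ‖z‖
    rw [Real.dist_eq, Real.dist_eq] at h1
    have h2 := abs_norm_sub_norm_le y z
    have h3 : |y i - z i| ≤ dist y z := by
      rw [dist_eq_norm]; simpa using PiLp.norm_apply_le (y - z) i
    have h4 : |y i| ≤ 2 * s := (by simpa using PiLp.norm_apply_le y i : |y i| ≤ ‖y‖).trans hy
    rw [e]
    refine (abs_add_le _ _).trans ?_
    rw [abs_mul, abs_mul]
    have h5 : |pp n s ‖y‖ - pp n s ‖z‖| ≤ A * dist y z := h1.trans (by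
      rw [dist_eq_norm]; exact mul_le_mul_of_nonneg_left h2 A.2)
    have h6 := mul_le_mul h4 h5 (abs_nonneg _) (by positivity)
    have h7 := mul_le_mul h3 (pp_bd n hs ‖z‖) (abs_nonneg _) (by positivity)
    linarith
  apply LipschitzWith.of_dist_le_mul
  intro y z
  push_cast
  rw [Real.coe_toNNReal _ (by positivity), Real.coe_toNNReal _ (by positivity), Real.dist_eq]
  by_cases hy : ‖y‖ ≤ 2 * s
  · exact key y z hy
  by_cases hz : ‖z‖ ≤ 2 * s
  · rw [abs_sub_comm, dist_comm]; exact key z y hz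
  rw [VV_zero hs i y (by simpa using hy), VV_zero hs i z (by simpa using hz)]
  simp only [sub_self, abs_zero]
  positivity

lemma VV_near {n : ℕ} {s : ℝ} (hs : 0 < s) (i j : Fin n) (y : EE n) (hy : ‖y‖ < s) :
    dd j (VV s i) y = (if i = j then 1 else 0) * ((s ^ n)⁻¹ - ((2 * s) ^ n)⁻¹) := by
  have h1 : VV s i =ᶠ[𝓝 y] fun z => z i * ((s ^ n)⁻¹ - ((2 * s) ^ n)⁻¹) := by
    filter_upwards [isOpen_ball.mem_nhds (mem_ball_zero_iff.2 hy)] with z hz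
    rw [mem_ball_zero_iff] at hz
    rw [VV, pp, max_eq_left (min_le_of_left_le hz.le)]
  rw [dd_congr h1]
  have : HasDerivAt (fun t : ℝ => (y + t • stdVec n j) i * ((s ^ n)⁻¹ - ((2 * s) ^ n)⁻¹))
      ((if i = j then 1 else 0) * ((s ^ n)⁻¹ - ((2 * s) ^ n)⁻¹)) 0 := by
    apply HasDerivAt.mul_const
    have := ((hasDerivAt_id (0:ℝ)).mul_const ((stdVec n j) i)).const_add (y i)
    simpa [stdVec, Pi.single_apply] using this
  exact HasLineDerivAt.lineDeriv this

lemma VV_mid {n : ℕ} {s : ℝ} (hs : 0 < s) (i j : Fin n) (y : EE n) (hy : s < ‖y‖) (hy2 : ‖y‖ < 2 * s) :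
    dd j (VV s i) y = (if i = j then 1 else 0) * ((‖y‖ ^ n)⁻¹ - ((2 * s) ^ n)⁻¹)
      - n * (y i * y j) * (‖y‖ ^ n)⁻¹ * (‖y‖ ^ 2)⁻¹ := by
  have hy0 : 0 < ‖y‖ := hs.trans hy
  have h1 : VV s i =ᶠ[𝓝 y] fun z => z i * ((‖z‖ ^ n)⁻¹ - ((2 * s) ^ n)⁻¹) := by
    have c : Continuous (fun z : EE n => ‖z‖) := continuous_norm
    filter_upwards [c.continuousAt.eventually_lt continuousAt_const hy2,
      continuousAt_const.eventually_lt c.continuousAt hy] with z hz1 hz2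
    rw [VV, pp, min_eq_left hz1.le, max_eq_right hz2.le]
  rw [dd_congr h1]
  have hN : HasDerivAt (fun t : ℝ => ‖y + t • stdVec n j‖) (y j / ‖y‖) 0 := by
    have e : ∀ t : ℝ, ‖y + t • stdVec n j‖ = Real.sqrt (‖y‖ ^ 2 + (2 * y j) * t + t ^ 2) := by
      intro t
      rw [← Real.sqrt_sq (norm_nonneg _), norm_add_sq_real, norm_smul, norm_stdVec, inner_smul_right]
      congr 1
      simp [stdVec, EuclideanSpace.inner_single_right]
      ring
    simp only [e]
    have h2 : HasDerivAt (fun t : ℝ => ‖y‖ ^ 2 + (2 * y j) * t + t ^ 2) (2 * y j) 0 := by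
      have := (((hasDerivAt_id (0:ℝ)).const_mul (2 * y j)).const_add (‖y‖ ^ 2)).add ((hasDerivAt_id (0:ℝ)).pow 2)
      exact (this.congr_deriv (by simp)).congr_of_eventuallyEq (Eventually.of_forall fun t => by simp)
    have h3 := h2.sqrt (by simp; exact norm_pos_iff.1 hy0)
    simp only [mul_zero, add_zero, ne_eq, OfNat.ofNat_ne_zero, not_false_eq_true, zero_pow,
      Real.sqrt_sq (norm_nonneg y)] at h3
    convert h3 using 1
    field_simp
  have hc : HasDerivAt (fun t : ℝ => (y + t • stdVec n j) i) (if i = j then 1 else 0) 0 := by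
    have := ((hasDerivAt_id (0:ℝ)).mul_const ((stdVec n j) i)).const_add (y i)
    simpa [stdVec, Pi.single_apply] using this
  have hq := ((hN.pow n).inv (by simp; intro h; simp [h] at hy0)).sub_const (((2 * s) ^ n)⁻¹)
  have h4 := hc.mul hq
  have h5 : HasLineDerivAt ℝ (fun z => z i * ((‖z‖ ^ n)⁻¹ - ((2 * s) ^ n)⁻¹)) _ y (stdVec n j) := h4
  rw [dd, h5.lineDeriv]
  simp only [zero_smul, add_zero, Pi.pow_apply, Pi.inv_apply]
  rcases n with _ | m
  · exact i.elim0
  simp only [Nat.add_sub_cancel]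
  field_simp
  ring


lemma VV_ae {n : ℕ} {s : ℝ} (hs : 0 < s) : ∀ᵐ y : EE n,
    (∀ i j, dd j (VV s i) y = dd i (VV s j) y) ∧
    (∀ i j, |dd j (VV s i) y| ≤ (n + 1) * (s ^ n)⁻¹) ∧
    (∑ i, dd i (VV s i) y = (ball 0 s).indicator (fun _ => n * (s ^ n)⁻¹) y
      - (ball 0 (2 * s)).indicator (fun _ => n * ((2 * s) ^ n)⁻¹) y) ∧
    (∀ i j, y ∉ ball 0 (2 * s) → dd j (VV s i) y = 0) := by
  have s1 : ∀ᵐ y : EE n, y ∉ sphere (0 : EE n) s :=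
    measure_eq_zero_iff_ae_notMem.1 (Measure.addHaar_sphere_of_ne_zero _ _ hs.ne')
  have s2 : ∀ᵐ y : EE n, y ∉ sphere (0 : EE n) (2 * s) :=
    measure_eq_zero_iff_ae_notMem.1 (Measure.addHaar_sphere_of_ne_zero _ _ (by positivity))
  filter_upwards [s1, s2] with y h1 h2
  rw [mem_sphere_zero_iff_norm] at h1 h2
  have hsn : 0 < (s ^ n)⁻¹ := by positivity
  have hn0 : (0:ℝ) ≤ n := Nat.cast_nonneg n
  have h2s : 0 < ((2 * s) ^ n)⁻¹ := by positivity
  have h2s' : ((2 * s) ^ n)⁻¹ ≤ (s ^ n)⁻¹ := by gcongr; linarith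
  rcases lt_or_gt_of_ne h1 with h | h
  · have e := fun i j => VV_near hs i j y h
    have m1 : y ∈ ball (0 : EE n) s := by simpa using h
    have m2 : y ∈ ball (0 : EE n) (2 * s) := by simp; linarith
    refine ⟨fun i j => ?_, fun i j => ?_, ?_, fun i j hh => absurd m2 hh⟩
    · rw [e, e]; simp only [eq_comm]
    · rw [e]
      split_ifs
      · rw [one_mul, abs_of_nonneg (by linarith)]; nlinarith
      · simp; positivity
    · simp only [e, indicator_of_mem m1, indicator_of_mem m2]
      simp [mul_sub]
  rcases lt_or_gt_of_ne h2 with h' | h'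
  · have e := fun i j => VV_mid hs i j y h h'
    have m1 : y ∉ ball (0 : EE n) s := by simp; linarith
    have m2 : y ∈ ball (0 : EE n) (2 * s) := by simpa using h'
    have hy0 : 0 < ‖y‖ := hs.trans h
    have g1 : (‖y‖ ^ n)⁻¹ ≤ (s ^ n)⁻¹ := by gcongr
    have g2 : ((2 * s) ^ n)⁻¹ ≤ (‖y‖ ^ n)⁻¹ := by gcongr
    refine ⟨fun i j => ?_, fun i j => ?_, ?_, fun i j hh => absurd m2 hh⟩
    · rw [e, e]; simp only [eq_comm, mul_comm (y i)]
    · rw [e]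
      have b1 : |(if i = j then (1:ℝ) else 0) * ((‖y‖ ^ n)⁻¹ - ((2 * s) ^ n)⁻¹)| ≤ (s ^ n)⁻¹ := by
        split_ifs
        · rw [one_mul, abs_of_nonneg (by linarith)]; linarith
        · simp; positivity
      have c1 : |y i| ≤ ‖y‖ := by simpa using PiLp.norm_apply_le y i
      have c2 : |y j| ≤ ‖y‖ := by simpa using PiLp.norm_apply_le y j
      have b2 : |n * (y i * y j) * (‖y‖ ^ n)⁻¹ * (‖y‖ ^ 2)⁻¹| ≤ n * (s ^ n)⁻¹ := by
        rw [abs_mul, abs_mul, abs_mul, abs_mul, abs_of_nonneg hn0, abs_of_nonneg (a := (‖y‖ ^ n)⁻¹) (by positivity),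
          abs_of_nonneg (a := (‖y‖ ^ 2)⁻¹) (by positivity)]
        have c3 : |y i| * |y j| ≤ ‖y‖ ^ 2 := by rw [pow_two]; gcongr
        calc n * (|y i| * |y j|) * (‖y‖ ^ n)⁻¹ * (‖y‖ ^ 2)⁻¹ ≤ n * (‖y‖ ^ 2) * (s ^ n)⁻¹ * (‖y‖ ^ 2)⁻¹ := by gcongr
          _ = n * (s ^ n)⁻¹ := by field_simp
      refine (abs_sub _ _).trans ?_
      linarith
    · simp only [e, indicator_of_notMem m1, indicator_of_mem m2]
      rw [Finset.sum_sub_distrib, ← Finset.sum_mul, ← Finset.sum_mul, ← Finset.sum_mul, ← Finset.mul_sum]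
      have : ∑ i, y i * y i = ‖y‖ ^ 2 := by
        rw [EuclideanSpace.real_norm_sq_eq]; simp only [pow_two]
      rw [this]
      simp
      field_simp
      ring
  · have m1 : y ∉ ball (0 : EE n) s := by simp; linarith
    have m2 : y ∉ ball (0 : EE n) (2 * s) := by simp; linarith
    have m3 : y ∉ closedBall (0 : EE n) (2 * s) := by simpa using h'
    have e : ∀ i j, dd j (VV s i) y = 0 := fun i j => dd_zero (fun z hz => VV_zero hs i z hz) j y m3
    refine ⟨fun i j => by rw [e, e], fun i j => ?_, ?_, fun i j _ => e i j⟩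
    · rw [e]; simp; positivity
    · simp [e, m1, m2, -mem_ball]

lemma tele0 {n : ℕ} {F : Fin n → EE n → ℝ} {A : NNReal} (hF : ∀ j, LipschitzWith A (F j))
    {s : ℝ} (hs : 0 < s) (k j : Fin n) :
    |avg s (dd k (F j)) 0 - avg (2 * s) (dd k (F j)) 0| ≤
      2 * 2 ^ n * avg (2 * s) (fun y => |∑ i, dd i (F i) y| + ∑ i, |dd i (F j) y - dd j (F i) y|) 0 := by
  have hn : (1:ℝ) ≤ n := by exact_mod_cast Fin.pos k
  obtain ⟨L, hL⟩ := VV_lip (n := n) hs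
  have hae := VV_ae (n := n) hs
  have hz : ∀ i j, ∀ y, y ∉ closedBall (0 : EE n) (2 * s) → dd i (VV s j) y = 0 :=
    fun i j => dd_zero (fun z hz => VV_zero hs j z hz) i
  have hcs : ∀ i, HasCompactSupport (VV (n := n) s i) := fun i =>
    HasCompactSupport.intro (isCompact_closedBall 0 (2 * s)) (fun y hy => VV_zero hs i y hy)
  have hI : ∀ (i l : Fin n) (h : EE n → ℝ), BM h → Integrable (fun y => dd i (VV s l) y * h y) := by
    intro i l h hh
    apply BM.integrable_zero ((dd_BM (hL l) i).mul hh) 0 (2 * s)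
    intro y hy; rw [hz i l y hy, zero_mul]
  have bD : ∀ i j, BM (dd i (F j)) := fun i j => dd_BM (hF j) i
  have e1 : ∫ y, (∑ i, dd i (VV s i) y) * dd k (F j) y =
      n * om n * (avg s (dd k (F j)) 0 - avg (2 * s) (dd k (F j)) 0) := by
    have i1 : Integrable ((ball (0 : EE n) s).indicator (fun y => n * (s ^ n)⁻¹ * dd k (F j) y)) :=
      (((bD k j).cmul _).iball 0 s).integrable_indicator measurableSet_ball
    have i2 : Integrable ((ball (0 : EE n) (2 * s)).indicator (fun y => n * ((2 * s) ^ n)⁻¹ * dd k (F j) y)) :=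
      (((bD k j).cmul _).iball 0 (2 * s)).integrable_indicator measurableSet_ball
    have : ∫ y, (∑ i, dd i (VV s i) y) * dd k (F j) y =
        ∫ y, ((ball (0 : EE n) s).indicator (fun y => n * (s ^ n)⁻¹ * dd k (F j) y) y
          - (ball (0 : EE n) (2 * s)).indicator (fun y => n * ((2 * s) ^ n)⁻¹ * dd k (F j) y) y) := by
      apply integral_congr_ae
      filter_upwards [hae] with y hy
      rw [hy.2.2.1]
      simp only [indicator]
      split_ifs <;> ring
    rw [this, integral_sub i1 i2, integral_indicator measurableSet_ball, integral_indicator measurableSet_ball,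
      integral_const_mul, integral_const_mul, avg_eq hs, avg_eq (by positivity : 0 < 2 * s)]
    simp only [zero_add]
    have := (om_pos n).ne'
    field_simp
  have e2 : ∫ y, (∑ i, dd i (VV s i) y) * dd k (F j) y =
      ∫ y, ((∑ i, dd k (VV s i) y * (dd i (F j) y - dd j (F i) y)) + dd j (VV s k) y * ∑ i, dd i (F i) y) := by
    have r1 : ∀ i, Integrable (fun y => dd k (VV s i) y * (dd i (F j) y - dd j (F i) y)) :=
      fun i => hI k i _ ((bD i j).sub (bD j i))
    rw [integral_add (integrable_finsetSum _ fun i _ => r1 i) (hI j k _ (BM.sum _ fun i => bD i i)),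
      integral_finsetSum _ fun i _ => r1 i]
    simp only [Finset.sum_mul, Finset.mul_sum]
    rw [integral_finsetSum _ fun i _ => hI i i _ (bD k j), integral_finsetSum _ fun i _ => hI j k _ (bD i i),
      ← Finset.sum_add_distrib]
    refine Finset.sum_congr rfl fun i _ => ?_
    have t1 : ∫ y, dd i (VV s i) y * dd k (F j) y = ∫ y, dd k (VV s i) y * dd i (F j) y :=
      swap_deriv (hL i) (hF j) (hcs i) _ _
    have t2 : ∫ y, dd i (VV s k) y * dd j (F i) y = ∫ y, dd j (VV s k) y * dd i (F i) y :=
      swap_deriv (hL k) (hF i) (hcs k) _ _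
    have t3 : ∫ y, dd k (VV s i) y * dd j (F i) y = ∫ y, dd i (VV s k) y * dd j (F i) y := by
      apply integral_congr_ae
      filter_upwards [hae] with y hy
      simp only [hy.1 i k]
    simp only [mul_sub]
    rw [integral_sub (hI k i _ (bD i j)) (hI k i _ (bD j i)), t1, t3, t2]
    ring
  set h := fun y => |∑ i, dd i (F i) y| + ∑ i, |dd i (F j) y - dd j (F i) y| with hh
  have babs : ∀ {f : EE n → ℝ}, BM f → BM (fun y => |f y|) := fun {f} hf =>
    ⟨hf.1.abs, hf.2.imp fun C hC x => by simpa using hC x⟩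
  have bh : BM h := (babs (BM.sum _ fun i => bD i i)).add (BM.sum _ fun i => babs ((bD i j).sub (bD j i)))
  have i3 : Integrable ((ball (0 : EE n) (2 * s)).indicator (fun y => (n + 1) * (s ^ n)⁻¹ * h y)) :=
      ((bh.cmul _).iball 0 (2 * s)).integrable_indicator measurableSet_ball
  have e3 : |∫ y, (∑ i, dd i (VV s i) y) * dd k (F j) y| ≤
      ∫ y, (ball (0 : EE n) (2 * s)).indicator (fun y => (n + 1) * (s ^ n)⁻¹ * h y) y := by
    rw [e2, ← Real.norm_eq_abs]
    apply norm_integral_le_of_norm_le i3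
    filter_upwards [hae] with y hy
    rw [Real.norm_eq_abs]
    by_cases hm : y ∈ ball (0 : EE n) (2 * s)
    · rw [indicator_of_mem hm, hh]
      simp only [mul_add]
      refine (abs_add_le _ _).trans ?_
      rw [add_comm, abs_mul]
      refine add_le_add (mul_le_mul_of_nonneg_right (hy.2.1 _ _) (abs_nonneg _)) ?_
      rw [Finset.mul_sum]
      refine (Finset.abs_sum_le_sum_abs _ _).trans (Finset.sum_le_sum fun i _ => ?_)
      rw [abs_mul]
      exact mul_le_mul_of_nonneg_right (hy.2.1 _ _) (abs_nonneg _)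
    · simp [indicator_of_notMem hm, hy.2.2.2 _ _ hm]
  rw [e1, integral_indicator measurableSet_ball, integral_const_mul] at e3
  rw [avg_eq (by positivity : 0 < 2 * s) h]
  simp only [zero_add]
  have ho := om_pos n
  rw [abs_mul, abs_of_pos (by positivity)] at e3
  have hI0 : 0 ≤ ∫ y in ball 0 (2 * s), h y := integral_nonneg fun y => by
    simp only [hh]; positivity
  set I := ∫ y in ball 0 (2 * s), h y
  set d := |avg s (dd k (F j)) 0 - avg (2 * s) (dd k (F j)) 0|
  have g : 2 * 2 ^ n * (((2 * s) ^ n * om n)⁻¹ * I) = 2 * (s ^ n)⁻¹ * (om n)⁻¹ * I := by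
    rw [mul_pow]; field_simp
  rw [g]
  have g2 : (n + 1) * (s ^ n)⁻¹ * I ≤ n * (2 * (s ^ n)⁻¹ * I) := by
    have : 0 ≤ (s ^ n)⁻¹ * I := by positivity
    nlinarith
  have g3 : n * (om n * d) ≤ n * (2 * (s ^ n)⁻¹ * I) := by linarith
  have g4 := le_of_mul_le_mul_left g3 (by linarith)
  calc d = (om n)⁻¹ * (om n * d) := by field_simp
    _ ≤ (om n)⁻¹ * (2 * (s ^ n)⁻¹ * I) := by gcongr
    _ = _ := by ring

lemma tele_pt {n : ℕ} (p : Fin n → Fin n → ℝ) (j : Fin n) :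
    (|∑ i, p i i| + ∑ i, |p i j - p j i|) ^ 2 ≤ (n + 1) *
      ((∑ i, p i i) ^ 2 + ∑ i, ∑ j, (p i j - p j i) ^ 2) := by
  have h1 : (∑ i, |p i j - p j i|) ^ 2 ≤ n * ∑ i, ∑ j, (p i j - p j i) ^ 2 := by
    have := Finset.sum_mul_sq_le_sq_mul_sq Finset.univ (fun _ : Fin n => (1:ℝ)) (fun i => |p i j - p j i|)
    simp at this
    refine this.trans ?_
    gcongr with i _
    exact Finset.single_le_sum (f := fun j => (p i j - p j i) ^ 2) (fun _ _ => sq_nonneg _) (Finset.mem_univ j)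
  set a := |∑ i, p i i|
  have ha : (∑ i, p i i) ^ 2 = a ^ 2 := (sq_abs _).symm
  rw [ha]
  set b := ∑ i, |p i j - p j i|
  set S := ∑ i, ∑ j, (p i j - p j i) ^ 2
  have hS : 0 ≤ S := by positivity
  have hn : (1:ℝ) ≤ n := by exact_mod_cast Fin.pos j
  have h2 : 2 * (a * b) ≤ n * a ^ 2 + S := by
    have h3 : 0 ≤ (n * a - b) ^ 2 := sq_nonneg _
    have h4 : n * (2 * (a * b)) ≤ n * (n * a ^ 2 + S) := by nlinarith
    exact le_of_mul_le_mul_left h4 (by linarith)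
  nlinarith

lemma avg_shift {n : ℕ} {s : ℝ} (h : EE n → ℝ) (x : EE n) : avg s (fun y => h (x + y)) 0 = avg s h x := by
  simp [avg]

lemma tele {n : ℕ} {F : Fin n → EE n → ℝ} {A : NNReal} (hF : ∀ j, LipschitzWith A (F j))
    {s : ℝ} (hs : 0 < s) (k j : Fin n) (x : EE n) :
    (avg s (dd k (F j)) x - avg (2 * s) (dd k (F j)) x) ^ 2 ≤
      (2 * 2 ^ n) ^ 2 * (n + 1) * avg (2 * s) (GG F) x := by
  have hs2 : 0 < 2 * s := by positivity
  have := nu_prob (n := n) hs2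
  set F' : Fin n → EE n → ℝ := fun j y => F j (x + y) with hF'
  have hl : ∀ j, LipschitzWith A (F' j) := fun j => LipschitzWith.of_dist_le_mul fun y z => by
    simpa [hF'] using (hF j).dist_le_mul (x + y) (x + z)
  have hd : ∀ i j, dd i (F' j) = fun y => dd i (F j) (x + y) := by
    intro i j; ext y; simp only [dd, lineDeriv, hF', add_assoc]
  have h1 := tele0 hl hs k j
  simp only [hd] at h1
  set h := fun y => |∑ i, dd i (F i) y| + ∑ i, |dd i (F j) y - dd j (F i) y| with hh
  rw [avg_shift (dd k (F j)), avg_shift (dd k (F j)), avg_shift h] at h1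
  have bD : ∀ i j, BM (dd i (F j)) := fun i j => dd_BM (hF j) i
  have babs : ∀ {f : EE n → ℝ}, BM f → BM (fun y => |f y|) := fun {f} hf =>
    ⟨hf.1.abs, hf.2.imp fun C hC x => by simpa using hC x⟩
  have bh : BM h := (babs (BM.sum _ fun i => bD i i)).add (BM.sum _ fun i => babs ((bD i j).sub (bD j i)))
  have j1 := jensen_sq (nu n (2 * s)) (bh.comp (measurable_const_add x))
  have j2 : ∫ y, h (x + y) ^ 2 ∂(nu n (2 * s)) ≤ (n + 1) * avg (2 * s) (GG F) x := by
    rw [avg, ← integral_const_mul]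
    apply integral_mono ((bh.comp (measurable_const_add x)).sq.integrable _)
      ((((GG_BM hF).comp (measurable_const_add x)).cmul _).integrable _)
    intro y
    exact tele_pt (fun i j => dd i (F j) (x + y)) j
  calc _ = |avg s (dd k (F j)) x - avg (2 * s) (dd k (F j)) x| ^ 2 := (sq_abs _).symm
    _ ≤ (2 * 2 ^ n * avg (2 * s) h x) ^ 2 := pow_le_pow_left₀ (abs_nonneg _) h1 2
    _ = (2 * 2 ^ n) ^ 2 * (avg (2 * s) h x) ^ 2 := by ring
    _ ≤ (2 * 2 ^ n) ^ 2 * ((n + 1) * avg (2 * s) (GG F) x) := by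
        gcongr; exact j1.trans j2
    _ = _ := by ring


lemma cover_fin (n : ℕ) (R : ℝ) : ∃ t : Finset (EE n), ball (0 : EE n) R ⊆ ⋃ c ∈ t, ball c 1 := by
  have := (isCompact_closedBall (0 : EE n) R).elim_finite_subcover (fun c : EE n => ball c 1)
    (fun c => isOpen_ball) (fun x _ => mem_iUnion.2 ⟨x, mem_ball_self one_pos⟩)
  obtain ⟨t, ht⟩ := this
  exact ⟨t, ball_subset_closedBall.trans ht⟩

lemma setIntegral_union_le_add {n : ℕ} {h : EE n → ℝ} {s t : Set (EE n)} (hs : IntegrableOn h s)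
    (ht : IntegrableOn h t) (h0 : ∀ x, 0 ≤ h x) :
    ∫ y in s ∪ t, h y ≤ (∫ y in s, h y) + ∫ y in t, h y := by
  rw [← integral_add_measure hs ht]
  exact integral_mono_measure (Measure.restrict_union_le s t) (ae_of_all _ h0) (Integrable.add_measure hs ht)

lemma cover_int (n : ℕ) (R : ℝ) : ∃ N : ℕ, 1 ≤ N ∧ ∀ h : EE n → ℝ, BM h → (∀ x, 0 ≤ h x) → ∀ r : ℝ, 0 < r → ∀ A,
    (∀ z, ∫ y in ball z r, h y ≤ A) → ∀ x, ∫ y in ball x (R * r), h y ≤ N * A := by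
  obtain ⟨t, ht⟩ := cover_fin n R
  refine ⟨t.card + 1, by omega, fun h hB h0 r hr A hA x => ?_⟩
  have hA0 : 0 ≤ A := (integral_nonneg h0).trans (hA 0)
  have sub : ball x (R * r) ⊆ ⋃ c ∈ t, ball (x + r • c) r := by
    intro y hy
    have h1 : r⁻¹ • (y - x) ∈ ball (0 : EE n) R := by
      rw [mem_ball_zero_iff, norm_smul, norm_inv, Real.norm_of_nonneg hr.le, inv_mul_lt_iff₀ hr]
      rw [mem_ball, dist_eq_norm] at hy; linarith
    obtain ⟨c, hc, h2⟩ := mem_iUnion₂.1 (ht h1)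
    refine mem_iUnion₂.2 ⟨c, hc, ?_⟩
    rw [mem_ball, dist_eq_norm] at h2 ⊢
    have e : y - (x + r • c) = r • (r⁻¹ • (y - x) - c) := by
      rw [smul_sub, smul_smul, mul_inv_cancel₀ hr.ne', one_smul]; abel
    rw [e, norm_smul, Real.norm_of_nonneg hr.le]
    nlinarith
  have hi : ∀ s : Finset (EE n), IntegrableOn h (⋃ c ∈ s, ball (x + r • c) r) ∧
      ∫ y in ⋃ c ∈ s, ball (x + r • c) r, h y ≤ s.card * A := by
    classical
    intro s
    induction s using Finset.induction_on with
    | empty => simp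
    | insert a s ha ih =>
      rw [Finset.set_biUnion_insert, Finset.card_insert_of_notMem ha]
      refine ⟨(hB.iball _ _).union ih.1, ?_⟩
      have := setIntegral_union_le_add (hB.iball (x + r • a) r) ih.1 h0
      push_cast
      have := hA (x + r • a)
      linarith [ih.2]
  have h3 := setIntegral_mono_set (hi t).1 (ae_of_all _ h0) sub.eventuallyLE
  have := (hi t).2
  push_cast
  nlinarith

lemma dyadic (a : ℝ → ℝ) {β K0 K1 : ℝ} (hβ : 0 < β) (hK0 : 0 ≤ K0) (hK1 : 0 ≤ K1)
    (h0 : ∀ s, 1 / 2 < s → s ≤ 1 → a s ≤ K0)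
    (h1 : ∀ s, 0 < s → s ≤ 1 / 2 → a s ≤ a (2 * s) + K1 * (2 * s) ^ (-β)) :
    ∀ s, 0 < s → s ≤ 1 → a s ≤ (K0 + K1 * (2 ^ (-β) / (1 - 2 ^ (-β)))) * s ^ (-β) := by
  set q : ℝ := 2 ^ (-β) with hq
  have q0 : 0 < q := by positivity
  have q1 : q < 1 := Real.rpow_lt_one_of_one_lt_of_neg (by norm_num) (by linarith)
  have q2 : 0 < 1 - q := by linarith
  have key : ∀ m : ℕ, ∀ s, 0 < s → s ≤ 1 → 1 < 2 ^ (m + 1) * s →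
      a s ≤ (K0 + K1 * (q / (1 - q))) * s ^ (-β) := by
    intro m
    induction m with
    | zero =>
      intro s hs hs1 h
      have e : (1:ℝ) ≤ s ^ (-β) := Real.one_le_rpow_of_pos_of_le_one_of_nonpos hs hs1 (by linarith)
      have := h0 s (by norm_num at h; linarith) hs1
      have g : 0 ≤ K1 * (q / (1 - q)) := by positivity
      nlinarith
    | succ m ih =>
      intro s hs hs1 h
      by_cases hh : 1 / 2 < s
      · have e : (1:ℝ) ≤ s ^ (-β) := Real.one_le_rpow_of_pos_of_le_one_of_nonpos hs hs1 (by linarith)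
        have := h0 s hh hs1
        have g : 0 ≤ K1 * (q / (1 - q)) := by positivity
        nlinarith
      · push Not at hh
        have i := ih (2 * s) (by linarith) (by linarith) (by rw [pow_succ] at h; linarith)
        have j := h1 s hs hh
        rw [Real.mul_rpow (by norm_num) hs.le, ← hq] at i j
        set S := s ^ (-β)
        have hS : 0 < S := by positivity
        have e : K1 * (q * S) + K1 * (q / (1 - q)) * (q * S) = K1 * (q / (1 - q)) * S := by
          field_simp; ring
        have e2 : K0 * (q * S) ≤ K0 * S := by
          apply mul_le_mul_of_nonneg_left _ hK0; nlinarith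
        nlinarith
  intro s hs hs1
  obtain ⟨m, hm⟩ := pow_unbounded_of_one_lt (1 / s) (by norm_num : (1:ℝ) < 2)
  apply key m s hs hs1
  rw [div_lt_iff₀ hs] at hm
  rw [pow_succ]
  nlinarith

def MB {n : ℕ} (l : ℝ) (h : EE n → ℝ) (A : ℝ) : Prop :=
  ∀ x r, 0 < r → r ≤ 1 → ∫ y in ball x r, h y ≤ A * r ^ l

lemma avg_ball_le {n : ℕ} {s : ℝ} (hs : 0 < s) (h : EE n → ℝ) (x : EE n) :
    avg s h x = (s ^ n * om n)⁻¹ * ∫ y in ball x s, h y := by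
  rw [avg_eq hs]
  congr 1
  rw [← integral_indicator measurableSet_ball, ← integral_indicator measurableSet_ball,
    ← integral_add_left_eq_self (fun y => (ball x s).indicator h y) x]
  congr 1
  ext y
  simp only [indicator, mem_ball, dist_eq_norm, sub_zero, add_sub_cancel_left]

lemma avg_sq {n : ℕ} {s : ℝ} (hs : 0 < s) {h : EE n → ℝ} (hh : BM h) (x : EE n) :
    (avg s h x) ^ 2 ≤ avg s (fun y => h y ^ 2) x := by
  have := nu_prob (n := n) hs
  exact jensen_sq _ (hh.comp (measurable_const_add x))

lemma avg_mono {n : ℕ} {s : ℝ} (hs : 0 < s) {h g : EE n → ℝ} (hh : BM h) (hg : BM g)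
    (hle : ∀ y, h y ≤ g y) (x : EE n) : avg s h x ≤ avg s g x := by
  have := nu_prob (n := n) hs
  exact integral_mono ((hh.comp (measurable_const_add x)).integrable _)
    ((hg.comp (measurable_const_add x)).integrable _) fun y => hle _

lemma avg_add {n : ℕ} {s : ℝ} (hs : 0 < s) {h g : EE n → ℝ} (hh : BM h) (hg : BM g)
    (x : EE n) : avg s (fun y => h y + g y) x = avg s h x + avg s g x := by
  have := nu_prob (n := n) hs
  exact integral_add ((hh.comp (measurable_const_add x)).integrable _)
    ((hg.comp (measurable_const_add x)).integrable _)

lemma avg_sub {n : ℕ} {s : ℝ} (hs : 0 < s) {h g : EE n → ℝ} (hh : BM h) (hg : BM g)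
    (x : EE n) : avg s (fun y => h y - g y) x = avg s h x - avg s g x := by
  have := nu_prob (n := n) hs
  exact integral_sub ((hh.comp (measurable_const_add x)).integrable _)
    ((hg.comp (measurable_const_add x)).integrable _)

lemma avg_sum {n : ℕ} {s : ℝ} (hs : 0 < s) {ι : Type*} (t : Finset ι) {h : ι → EE n → ℝ} (hh : ∀ i, BM (h i))
    (x : EE n) : avg s (fun y => ∑ i ∈ t, h i y) x = ∑ i ∈ t, avg s (h i) x := by
  have := nu_prob (n := n) hs
  exact integral_finsetSum _ fun i _ => (((hh i).comp (measurable_const_add x)).integrable _)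

lemma avg_GG {n : ℕ} {s : ℝ} (hs : 0 < s) {F : Fin n → EE n → ℝ} {A : NNReal}
    (hF : ∀ j, LipschitzWith A (F j)) (x : EE n) :
    (∑ j, avg s (dd j (F j)) x) ^ 2 + ∑ i, ∑ j, (avg s (dd i (F j)) x - avg s (dd j (F i)) x) ^ 2
      ≤ avg s (GG F) x := by
  have bD : ∀ i j, BM (dd i (F j)) := fun i j => dd_BM (hF j) i
  have bR : ∀ i j, BM (fun y => (dd i (F j) y - dd j (F i) y)) := fun i j => (bD i j).sub (bD j i)
  unfold GG
  rw [avg_add hs (BM.sum _ fun j => (bD j j)).sq (BM.sum _ fun i => BM.sum _ fun j => (bR i j).sq),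
    avg_sum hs _ (fun i => BM.sum _ fun j => (bR i j).sq)]
  refine add_le_add ?_ (Finset.sum_le_sum fun i _ => ?_)
  · rw [← avg_sum hs _ (fun j => bD j j)]
    exact avg_sq hs (BM.sum _ fun j => (bD j j)) x
  · rw [avg_sum hs _ (fun j => (bR i j).sq)]
    refine Finset.sum_le_sum fun j _ => ?_
    rw [← avg_sub hs (bD i j) (bD j i)]
    exact avg_sq hs (bR i j) x


lemma vol_ball_pow {n : ℕ} {l s : ℝ} (hs : 0 < s) : (s ^ n)⁻¹ * s ^ l = s ^ (-((n - l) / 2)) * s ^ (-((n - l) / 2)) := by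
  rw [← Real.rpow_natCast, ← Real.rpow_neg hs.le, ← Real.rpow_add hs, ← Real.rpow_add hs]
  congr 1; ring

/-- pointwise growth of averages -/
lemma avg_growth (n : ℕ) {l : ℝ} (hl : l < n) : ∃ K : ℝ, 0 ≤ K ∧ ∀ (F : Fin n → EE n → ℝ) (A B : NNReal),
    (∀ j, LipschitzWith A (F j)) → (∀ j x, |F j x| ≤ B) → ∀ E : ℝ, MB l (GG F) E →
    (∀ x, ∫ y in ball x 1, ∑ j, F j y ^ 2 ≤ E) → ∀ k j x s, 0 < s → s ≤ 1 →
    (avg s (dd k (F j)) x) ^ 2 ≤ K * E * (s ^ n)⁻¹ * s ^ l := by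
  obtain ⟨N, hN1, hN⟩ := cover_int n 2
  set β : ℝ := (n - l) / 2 with hβ
  have hβ0 : 0 < β := by rw [hβ]; linarith
  have ho := om_pos n
  set c0 : ℝ := Real.sqrt (2 ^ n * (om n)⁻¹ * (2 * N + 10 * n * N)) with hc0
  set c1 : ℝ := Real.sqrt ((2 * 2 ^ n) ^ 2 * (n + 1) * (om n)⁻¹) with hc1
  refine ⟨(c0 + c1 * (2 ^ (-β) / (1 - 2 ^ (-β)))) ^ 2, sq_nonneg _, ?_⟩
  intro F A B hF hb E hG hE k j x s hs hs1
  have bF : ∀ j, BM (F j) := fun j => BM_of_lip (hF j) (hb j)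
  have bS2 : BM (fun y => ∑ j, F j y ^ 2) := BM.sum _ fun j => (bF j).sq
  have hE0 : 0 ≤ E := (integral_nonneg fun y => by positivity).trans (hE 0)
  have base : ∀ s, 1 / 2 < s → s ≤ 1 → |avg s (dd k (F j)) x| ≤ c0 * Real.sqrt E := by
    intro s hs hs1
    have hs0 : 0 < s := by linarith
    rw [hc0, ← Real.sqrt_mul (by positivity)]
    apply Real.abs_le_sqrt
    have h1 := avg_sq hs0 (dd_BM (hF j) k) x
    have h2 : avg s (fun y => dd k (F j) y ^ 2) x ≤ avg s (SS F) x := by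
      apply avg_mono hs0 (dd_BM (hF j) k).sq (SS_BM hF)
      intro y
      exact (Finset.single_le_sum (f := fun j => dd k (F j) y ^ 2) (fun _ _ => sq_nonneg _) (Finset.mem_univ j)).trans
        (Finset.single_le_sum (f := fun k => ∑ j, dd k (F j) y ^ 2) (fun _ _ => by positivity) (Finset.mem_univ k))
    rw [avg_ball_le hs0 (SS F)] at h2
    have h3 : ∫ y in ball x s, SS F y ≤ ∫ y in ball x 1, SS F y :=
      setIntegral_mono_set ((SS_BM hF).iball _ _) (ae_of_all _ (SS_nonneg F)) (ball_subset_ball hs1).eventuallyLE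
    have h4 := caccioppoli hF hb x one_pos
    have h5 := hN _ (GG_BM hF) (GG_nonneg F) 1 one_pos E (fun z => by simpa using hG z 1 one_pos le_rfl) x
    have h6 := hN _ bS2 (fun y => by positivity) 1 one_pos E hE x
    have h7 : (s ^ n * om n)⁻¹ ≤ 2 ^ n * (om n)⁻¹ := by
      rw [mul_inv]
      gcongr
      rw [inv_le_comm₀ (by positivity) (by positivity), ← inv_pow]
      gcongr
      norm_num; linarith
    simp only [inv_one, one_pow, one_mul] at h4
    have h8 : ∫ y in ball x s, SS F y ≤ (2 * N + 10 * n * N) * E := by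
      have : (0:ℝ) ≤ 10 * n := by positivity
      nlinarith
    calc _ ≤ _ := h1.trans h2
      _ ≤ 2 ^ n * (om n)⁻¹ * ((2 * N + 10 * n * N) * E) := by
          gcongr
          exact integral_nonneg (SS_nonneg F)
      _ = _ := by ring
  have step : ∀ s, 0 < s → s ≤ 1 / 2 → |avg s (dd k (F j)) x| ≤ |avg (2 * s) (dd k (F j)) x|
      + c1 * Real.sqrt E * (2 * s) ^ (-β) := by
    intro s hs hs1
    have h2s : 0 < 2 * s := by linarith
    have h1 := tele hF hs k j x
    have h2 : avg (2 * s) (GG F) x ≤ (om n)⁻¹ * E * ((2 * s) ^ (-β) * (2 * s) ^ (-β)) := by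
      rw [avg_ball_le h2s, hβ, ← vol_ball_pow h2s]
      have := hG x (2 * s) h2s (by linarith)
      calc _ ≤ ((2 * s) ^ n * om n)⁻¹ * (E * (2 * s) ^ l) := by gcongr
        _ = _ := by rw [mul_inv]; ring
    have h3 : |avg s (dd k (F j)) x - avg (2 * s) (dd k (F j)) x| ≤ c1 * Real.sqrt E * (2 * s) ^ (-β) := by
      apply abs_le_of_sq_le_sq _ (by positivity)
      rw [mul_pow, mul_pow, Real.sq_sqrt hE0, hc1, Real.sq_sqrt (by positivity)]
      refine h1.trans ?_
      calc _ ≤ (2 * 2 ^ n) ^ 2 * (n + 1) * ((om n)⁻¹ * E * ((2 * s) ^ (-β) * (2 * s) ^ (-β))) := by gcongr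
        _ = _ := by ring
    have := abs_sub_abs_le_abs_sub (avg s (dd k (F j)) x) (avg (2 * s) (dd k (F j)) x)
    linarith
  have fin := dyadic (fun s => |avg s (dd k (F j)) x|) hβ0 (by positivity) (by positivity) base step s hs hs1
  rw [mul_assoc, vol_ball_pow hs, ← hβ]
  have : |avg s (dd k (F j)) x| ^ 2 ≤ _ := pow_le_pow_left₀ (abs_nonneg _) fin 2
  rw [sq_abs] at this
  refine this.trans (le_of_eq ?_)
  have hE2 := Real.sq_sqrt hE0
  set e := Real.sqrt E
  rw [← hE2]
  ring

lemma GG_sub_pt {n : ℕ} (p q : Fin n → Fin n → ℝ) :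
    (∑ j, (p j j - q j j)) ^ 2 + ∑ i, ∑ j, ((p i j - q i j) - (p j i - q j i)) ^ 2 ≤
      2 * ((∑ j, p j j) ^ 2 + ∑ i, ∑ j, (p i j - p j i) ^ 2) +
      2 * ((∑ j, q j j) ^ 2 + ∑ i, ∑ j, (q i j - q j i) ^ 2) := by
  have h : ∀ a b : ℝ, (a - b) ^ 2 ≤ 2 * a ^ 2 + 2 * b ^ 2 := fun a b => by nlinarith [sq_nonneg (a + b)]
  have h1 := h (∑ j, p j j) (∑ j, q j j)
  rw [← Finset.sum_sub_distrib] at h1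
  have h2 : ∑ i, ∑ j, ((p i j - q i j) - (p j i - q j i)) ^ 2 ≤
      2 * (∑ i, ∑ j, (p i j - p j i) ^ 2) + 2 * (∑ i, ∑ j, (q i j - q j i) ^ 2) := by
    simp only [Finset.mul_sum, ← Finset.sum_add_distrib]
    refine Finset.sum_le_sum fun i _ => Finset.sum_le_sum fun j _ => ?_
    have := h (p i j - p j i) (q i j - q j i)
    rwa [sub_sub_sub_comm] at this
  linarith

lemma thmA_step (n : ℕ) {l : ℝ} (hl : l < n) : ∃ K : ℝ, 0 ≤ K ∧ ∀ (F : Fin n → EE n → ℝ) (A B : NNReal),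
    (∀ j, LipschitzWith A (F j)) → (∀ j x, |F j x| ≤ B) → ∀ E : ℝ, MB l (GG F) E →
    (∀ x, ∫ y in ball x 1, ∑ j, F j y ^ 2 ≤ E) → ∀ M, MB l (SS F) M → MB l (SS F) (M / 2 + K * E) := by
  obtain ⟨N, hN1, hN⟩ := cover_int n 2
  obtain ⟨K, hK0, hK⟩ := avg_growth n hl
  have ho := om_pos n
  obtain ⟨ε, hε0, hε1, hε⟩ : ∃ ε : ℝ, 0 < ε ∧ ε ≤ 1 ∧ 20 * n ^ 2 * N * ε ^ 2 ≤ 1 / 2 := by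
    have hp : (0:ℝ) < 40 * n ^ 2 * N + 1 := by positivity
    refine ⟨(40 * n ^ 2 * N + 1)⁻¹, by positivity, ?_, ?_⟩
    · apply inv_le_one_of_one_le₀
      have : (0:ℝ) ≤ 40 * n ^ 2 * N := by positivity
      linarith
    · have : (40 * n ^ 2 * N + 1 : ℝ)⁻¹ ≤ 1 := by
        apply inv_le_one_of_one_le₀
        have : (0:ℝ) ≤ 40 * n ^ 2 * N := by positivity
        linarith
      have h2 : 40 * n ^ 2 * N * (40 * n ^ 2 * N + 1 : ℝ)⁻¹ ≤ 1 := by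
        rw [← div_eq_mul_inv, div_le_one hp]; linarith
      have h3 : 0 ≤ (40 * n ^ 2 * N + 1 : ℝ)⁻¹ := by positivity
      generalize (40 * n ^ 2 * N + 1 : ℝ)⁻¹ = e at *
      have : 40 * n ^ 2 * N * e * e ≤ 1 * 1 := mul_le_mul h2 this h3 zero_le_one
      linarith
  refine ⟨16 * N + 2 * n ^ 2 * om n * K * ((ε ^ n)⁻¹ * ε ^ l), by positivity, ?_⟩
  intro F A B hF hb E hG hE M hM x r hr hr1
  have bF : ∀ j, BM (F j) := fun j => BM_of_lip (hF j) (hb j)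
  have hE0 : 0 ≤ E := (integral_nonneg fun y => by positivity).trans (hE 0)
  have hM0 : 0 ≤ M := by simpa using (integral_nonneg (SS_nonneg F)).trans (hM 0 1 one_pos le_rfl)
  set s := ε * r with hs
  have hs0 : 0 < s := by positivity
  have hs1 : s ≤ 1 := by rw [hs]; nlinarith
  have hrl : 0 < r ^ l := by positivity
  set w : Fin n → EE n → ℝ := fun j y => F j y - avg s (F j) y with hw
  have lw : ∀ j, LipschitzWith (A + A) (w j) := fun j => (hF j).sub (avg_lip hs0 (hF j) (hb j))
  have bav : ∀ j x, |avg s (F j) x| ≤ B := by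
    intro j x
    have := nu_prob (n := n) hs0
    have := norm_integral_le_of_norm_le_const (μ := nu n s) (f := fun y => F j (x + y)) (C := B)
      (Eventually.of_forall fun y => hb j _)
    simpa [avg] using this
  have bw : ∀ j x, |w j x| ≤ (B + B : NNReal) := fun j x => by
    push_cast
    exact (abs_sub _ _).trans (add_le_add (hb j x) (bav j x))
  have dw : ∀ᵐ y, ∀ i j, dd i (w j) y = dd i (F j) y - avg s (dd i (F j)) y := by
    rw [ae_all_iff]; intro i
    rw [ae_all_iff]; intro j
    filter_upwards [dd_sub (hF j) (avg_lip hs0 (hF j) (hb j)) i] with y hy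
    rw [← avg_dd hs0 (hF j) (hb j)]; exact hy
  have c := caccioppoli lw bw x hr
  have i1 : ∀ z, ∫ y in ball z r, ∑ j, w j y ^ 2 ≤ n * (s ^ 2 * (M * r ^ l)) := by
    intro z
    rw [integral_finsetSum _ fun j _ => (BM_of_lip (lw j) (bw j)).sq.iball _ _]
    calc _ ≤ ∑ j : Fin n, s ^ 2 * (M * r ^ l) := by
          refine Finset.sum_le_sum fun j _ => ?_
          apply avg_diff hs0 (hF j) (hb j) (by positivity)
          intro z
          refine le_trans ?_ (hM z r hr hr1)
          apply setIntegral_mono ((BM.sum _ fun k => (dd_BM (hF j) k).sq).iball _ _) ((SS_BM hF).iball _ _)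
          intro y
          exact Finset.sum_le_sum fun k _ =>
            Finset.single_le_sum (f := fun j => dd k (F j) y ^ 2) (fun _ _ => sq_nonneg _) (Finset.mem_univ j)
      _ = _ := by simp
  have i1' := hN _ (BM.sum _ fun j => (BM_of_lip (lw j) (bw j)).sq) (fun y => by positivity) r hr _ i1 x
  have i2 : ∀ z, ∫ y in ball z r, GG w y ≤ 4 * (E * r ^ l) := by
    intro z
    have := nu_prob (n := n) hs0
    have g1 : ∫ y in ball z r, GG w y ≤ ∫ y in ball z r, (2 * GG F y + 2 * avg s (GG F) y) := by
      apply setIntegral_mono_ae ((GG_BM lw).iball _ _)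
        ((((GG_BM hF).cmul 2).add ((avg_BM hs0 (GG_BM hF)).cmul 2)).iball _ _)
      filter_upwards [dw] with y hy
      have h1 := GG_sub_pt (fun i j => dd i (F j) y) (fun i j => avg s (dd i (F j)) y)
      have h2 := avg_GG hs0 hF y
      simp only [GG, hy]
      linarith
    rw [integral_add (((GG_BM hF).cmul 2).iball _ _) (((avg_BM hs0 (GG_BM hF)).cmul 2).iball _ _),
      integral_const_mul, integral_const_mul] at g1
    have g2 := hG z r hr hr1
    have g3 : ∫ y in ball z r, avg s (GG F) y ≤ E * r ^ l :=
      avg_trans (nu n s) (fun y => y) measurable_id (GG_BM hF) (fun z => hG z r hr hr1) z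
    linarith
  have i2' := hN _ (GG_BM lw) (GG_nonneg w) r hr _ i2 x
  have cS : ∀ᵐ y, SS F y ≤ 2 * SS w y + 2 * n ^ 2 * (K * E * (s ^ n)⁻¹ * s ^ l) := by
    filter_upwards [dw] with y hy
    have : ∀ i j, dd i (F j) y ^ 2 ≤ 2 * dd i (w j) y ^ 2 + 2 * (K * E * (s ^ n)⁻¹ * s ^ l) := by
      intro i j
      have h1 := hK F A B hF hb E hG hE i j y s hs0 hs1
      rw [hy]
      nlinarith [sq_nonneg (dd i (F j) y - 2 * avg s (dd i (F j)) y)]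
    calc SS F y ≤ ∑ i, ∑ j, (2 * dd i (w j) y ^ 2 + 2 * (K * E * (s ^ n)⁻¹ * s ^ l)) :=
          Finset.sum_le_sum fun i _ => Finset.sum_le_sum fun j _ => this i j
      _ = _ := by
          simp only [Finset.sum_add_distrib, ← Finset.mul_sum, SS]
          simp
          ring
  have f1 : ∫ y in ball x r, SS F y ≤ ∫ y in ball x r, (2 * SS w y + 2 * n ^ 2 * (K * E * (s ^ n)⁻¹ * s ^ l)) :=
    setIntegral_mono_ae ((SS_BM hF).iball _ _) ((((SS_BM lw).cmul 2).add (BM.const _)).iball _ _) cS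
  rw [integral_add (((SS_BM lw).cmul 2).iball _ _) ((BM.const _).iball _ _), integral_const_mul,
    setIntegral_const, vol_ball x hr, smul_eq_mul] at f1
  have e1 : r ^ n * om n * (2 * n ^ 2 * (K * E * (s ^ n)⁻¹ * s ^ l)) =
      2 * n ^ 2 * om n * K * ((ε ^ n)⁻¹ * ε ^ l) * E * r ^ l := by
    rw [hs, mul_pow, Real.mul_rpow hε0.le hr.le]
    field_simp
  have e2 : 10 * n * (r⁻¹ ^ 2 * (N * (n * (s ^ 2 * (M * r ^ l))))) = (10 * n ^ 2 * N * ε ^ 2) * (M * r ^ l) := by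
    rw [hs]; field_simp
  have e3 : 10 * n * (r⁻¹ ^ 2 * ∫ y in ball x (2 * r), ∑ j, w j y ^ 2) ≤ (10 * n ^ 2 * N * ε ^ 2) * (M * r ^ l) := by
    rw [← e2]; gcongr
  have hMr : 0 ≤ M * r ^ l := by positivity
  have e4 := mul_le_mul_of_nonneg_right hε hMr
  have : (M / 2 + (16 * N + 2 * n ^ 2 * om n * K * ((ε ^ n)⁻¹ * ε ^ l)) * E) * r ^ l =
    1 / 2 * (M * r ^ l) + 16 * (N * (E * r ^ l)) + 2 * n ^ 2 * om n * K * ((ε ^ n)⁻¹ * ε ^ l) * E * r ^ l := by ring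
  rw [this]
  linarith

theorem thmA (n : ℕ) {l : ℝ} (hl : l < n) : ∃ K : ℝ, 0 ≤ K ∧ ∀ (F : Fin n → EE n → ℝ) (A B : NNReal),
    (∀ j, LipschitzWith A (F j)) → (∀ j x, |F j x| ≤ B) → ∀ E : ℝ, MB l (GG F) E →
    (∀ x, ∫ y in ball x 1, ∑ j, F j y ^ 2 ≤ E) → MB l (SS F) (K * E) := by
  obtain ⟨K, hK0, hK⟩ := thmA_step n hl
  refine ⟨2 * K, by positivity, ?_⟩
  intro F A B hF hb E hG hE
  obtain ⟨C, hC⟩ := (SS_BM hF).2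
  have ho := om_pos n
  have hC0 : 0 ≤ C := (abs_nonneg _).trans (hC 0)
  have m0 : MB l (SS F) (C * om n) := by
    intro x r hr hr1
    calc ∫ y in ball x r, SS F y ≤ ∫ y in ball x r, C :=
          setIntegral_mono ((SS_BM hF).iball _ _) ((BM.const C).iball _ _) fun y => (le_abs_self _).trans (hC y)
      _ = C * om n * r ^ (n:ℝ) := by
          rw [setIntegral_const, vol_ball x hr, Real.rpow_natCast, smul_eq_mul]; ring
      _ ≤ C * om n * r ^ l := by
          apply mul_le_mul_of_nonneg_left _ (by positivity)
          exact Real.rpow_le_rpow_of_exponent_ge hr hr1 hl.le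
  have it : ∀ m : ℕ, MB l (SS F) (C * om n * (1 / 2) ^ m + 2 * K * E) := by
    have hE0 : 0 ≤ E := (integral_nonneg fun y => by positivity).trans (hE 0)
    intro m
    induction m with
    | zero =>
      intro x r hr hr1
      have := m0 x r hr hr1
      have h2 : 0 ≤ 2 * K * E * r ^ l := by positivity
      simp only [pow_zero, mul_one, add_mul]
      linarith
    | succ m ih =>
      have := hK F A B hF hb E hG hE _ ih
      convert this using 1
      rw [pow_succ]; ring
  intro x r hr hr1
  have t : Tendsto (fun m : ℕ => (C * om n * (1 / 2) ^ m + 2 * K * E) * r ^ l) atTop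
      (𝓝 ((C * om n * 0 + 2 * K * E) * r ^ l)) :=
    (((tendsto_pow_atTop_nhds_zero_of_lt_one (by norm_num) (by norm_num)).const_mul _).add_const _).mul_const _
  have := ge_of_tendsto' t (fun m => it m x r hr hr1)
  simpa using this


noncomputable def pd {n : ℕ} (k : Fin n) (h : EE n → ℝ) (x : EE n) : ℝ := fderiv ℝ h x (stdVec n k)

lemma Q_eq (n : ℕ) : unitCube n = (WithLp.ofLp : EE n → Fin n → ℝ) ⁻¹' (Icc 0 1) := by
  ext x; simp [unitCube, Pi.le_def, forall_and]

lemma vp_ofLp (n : ℕ) : MeasurePreserving (WithLp.ofLp : EE n → Fin n → ℝ) volume volume :=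
  PiLp.volume_preserving_ofLp _

lemma Q_compact (n : ℕ) : IsCompact (unitCube n) := by
  rw [Q_eq]
  exact (PiLp.homeomorph 2 (fun _ : Fin n => ℝ)).isCompact_preimage.2 isCompact_Icc

lemma Q_meas (n : ℕ) : MeasurableSet (unitCube n) := (Q_compact n).isClosed.measurableSet

lemma Q_vol (n : ℕ) : volume (unitCube n) = 1 := by
  rw [Q_eq, (vp_ofLp n).measure_preimage measurableSet_Icc.nullMeasurableSet]
  simp [Real.volume_Icc_pi]

lemma Q_convex (n : ℕ) : Convex ℝ (unitCube n) := by
  intro x hx y hy a b ha hb hab i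
  have := convex_Icc (0:ℝ) 1 (hx i) (hy i) ha hb hab
  simpa using this

instance Q_prob (n : ℕ) : IsProbabilityMeasure (volume.restrict (unitCube n)) := ⟨by simp [Q_vol]⟩

lemma Q_norm {n : ℕ} {x : EE n} (hx : x ∈ unitCube n) : ‖x‖ < n + 1 := by
  have h1 : ‖x‖ ^ 2 ≤ n := by
    rw [EuclideanSpace.real_norm_sq_eq]
    calc ∑ i, x i ^ 2 ≤ ∑ i : Fin n, (1:ℝ) := Finset.sum_le_sum fun i _ => by
          have := hx i; nlinarith [this.1, this.2]
      _ = n := by simp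
  have hn : (0:ℝ) ≤ n := Nat.cast_nonneg n
  nlinarith [norm_nonneg x]

lemma Q_dist {n : ℕ} {x y : EE n} (hx : x ∈ unitCube n) (hy : y ∈ unitCube n) : ‖y - x‖ < n + 1 := by
  have h1 : ‖y - x‖ ^ 2 ≤ n := by
    rw [EuclideanSpace.real_norm_sq_eq]
    calc ∑ i, (y - x) i ^ 2 ≤ ∑ i : Fin n, (1:ℝ) := Finset.sum_le_sum fun i _ => by
          have h1 := hx i
          have h2 := hy i
          simp only [PiLp.sub_apply]
          nlinarith [h1.1, h2.1, h1.2, h2.2]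
      _ = n := by simp
  have hn : (0:ℝ) ≤ n := Nat.cast_nonneg n
  nlinarith [norm_nonneg (y - x)]

lemma Q_int {n : ℕ} {h : EE n → ℝ} (hh : Continuous h) : IntegrableOn h (unitCube n) :=
  hh.continuousOn.integrableOn_compact (Q_compact n)

lemma jensen_int {α : Type*} [MeasurableSpace α] (ν : Measure α) [IsProbabilityMeasure ν]
    {h : α → ℝ} (hh : Integrable h ν) (h2 : Integrable (fun y => h y ^ 2) ν) :
    (∫ y, h y ∂ν) ^ 2 ≤ ∫ y, h y ^ 2 ∂ν := by
  set m := ∫ y, h y ∂ν with hm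
  have h0 : 0 ≤ ∫ y, (h y - m) ^ 2 ∂ν := integral_nonneg fun y => sq_nonneg _
  have e : ∀ y, (h y - m) ^ 2 = h y ^ 2 - (2 * m) * h y + m ^ 2 := fun y => by ring
  simp only [e] at h0
  have h3 : Integrable (fun y => h y ^ 2 - (2 * m) * h y) ν := h2.sub (hh.const_mul _)
  rw [integral_add h3 (integrable_const _),
    integral_sub h2 (hh.const_mul _), integral_const_mul] at h0
  simp only [integral_const, probReal_univ, one_smul, ← hm] at h0
  nlinarith

lemma pd_cont {n : ℕ} {h : EE n → ℝ} (hh : ContDiff ℝ 1 h) (k : Fin n) : Continuous (pd k h) :=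
  (hh.continuous_fderiv one_ne_zero).clm_apply continuous_const

lemma fd_sum {n : ℕ} (h : EE n → ℝ) (x z : EE n) : fderiv ℝ h x z = ∑ k, z k * pd k h x := by
  conv_lhs => rw [sum_stdVec z]
  simp [pd]

lemma ind_BM {n : ℕ} {h : EE n → ℝ} (hh : Continuous h) : BM ((unitCube n).indicator h) := by
  refine ⟨hh.measurable.indicator (Q_meas n), ?_⟩
  obtain ⟨C, hC⟩ := (Q_compact n).exists_bound_of_continuousOn hh.continuousOn
  refine ⟨max C 0, fun x => ?_⟩
  by_cases hx : x ∈ unitCube n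
  · rw [indicator_of_mem hx]; exact (hC x hx).trans (le_max_left _ _)
  · simp [hx]

lemma diff_sq {n : ℕ} {h : EE n → ℝ} (hh : ContDiff ℝ 1 h) {x z : EE n} (hx : x ∈ unitCube n)
    (hz : x + z ∈ unitCube n) : (h (x + z) - h x) ^ 2 ≤
      (n + 1) ^ 2 * ∫ t in Ioc (0:ℝ) 1, (unitCube n).indicator (fun y => ∑ k, pd k h y ^ 2) (x + t • z) := by
  have hp := prob01
  have hzn : ‖z‖ < n + 1 := by simpa using Q_dist hx hz
  have hin : ∀ t ∈ Ioc (0:ℝ) 1, x + t • z ∈ unitCube n := by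
    intro t ht
    exact (Q_convex n).add_smul_mem hx hz ⟨ht.1.le, ht.2⟩
  have hd : ∀ t : ℝ, HasDerivAt (fun t : ℝ => h (x + t • z)) (fderiv ℝ h (x + t • z) z) t := by
    intro t
    have h1 : HasDerivAt (fun t : ℝ => x + t • z) z t := by
      simpa using ((hasDerivAt_id t).smul_const z).const_add x
    exact ((hh.differentiable one_ne_zero _).hasFDerivAt.comp_hasDerivAt t h1)
  have hc : Continuous (fun t : ℝ => fderiv ℝ h (x + t • z) z) :=
    ((hh.continuous_fderiv one_ne_zero).comp (by fun_prop)).clm_apply continuous_const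
  have ftc : ∫ t in Ioc (0:ℝ) 1, fderiv ℝ h (x + t • z) z = h (x + z) - h x := by
    rw [← intervalIntegral.integral_of_le zero_le_one,
      intervalIntegral.integral_eq_sub_of_hasDerivAt (fun t _ => hd t) (hc.intervalIntegrable _ _)]
    simp
  have ii : ∀ {φ : ℝ → ℝ}, Continuous φ → Integrable φ (volume.restrict (Ioc (0:ℝ) 1)) := fun {φ} hφ =>
    hφ.integrableOn_Ioc
  rw [← ftc]
  refine (jensen_int _ (ii hc) (ii (hc.pow 2))).trans ?_
  rw [← integral_const_mul]
  have cG : Continuous (fun y => ∑ k, pd k h y ^ 2) := continuous_finsetSum _ fun k _ => (pd_cont hh k).pow 2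
  have bb := ((ind_BM cG).comp (by fun_prop : Measurable (fun t : ℝ => x + t • z))).cmul (((n:ℝ) + 1) ^ 2)
  apply setIntegral_mono_on (ii (hc.pow 2)) (bb.integrable _) measurableSet_Ioc
  intro t ht
  simp only [Pi.pow_apply]
  rw [indicator_of_mem (hin t ht), fd_sum]
  refine (Finset.sum_mul_sq_le_sq_mul_sq _ _ _).trans ?_
  gcongr
  rw [← EuclideanSpace.real_norm_sq_eq]
  gcongr

lemma lemP (n : ℕ) : ∃ C : ℝ, 0 < C ∧ ∀ h : EE n → ℝ, ContDiff ℝ 1 h → ∀ ρ K : ℝ,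
    (∀ z, ∫ y in ball z ρ ∩ unitCube n, ∑ k, pd k h y ^ 2 ≤ K) → ∀ x₀,
    ∫ x in ball x₀ ρ ∩ unitCube n, (h x - ∫ y in unitCube n, h y) ^ 2 ≤ C * K := by
  set R : ℝ := n + 1 with hR
  have hR0 : 0 < R := by positivity
  have ho := om_pos n
  refine ⟨R ^ 2 * (R ^ n * om n), by positivity, ?_⟩
  intro h hh ρ K hK x₀
  have hp := prob01
  have := nu_prob (n := n) hR0
  have cG : Continuous (fun y => ∑ k, pd k h y ^ 2) := continuous_finsetSum _ fun k _ => (pd_cont hh k).pow 2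
  have bG := ind_BM cG
  set G := (unitCube n).indicator (fun y => ∑ k, pd k h y ^ 2) with hG
  have G0 : ∀ y, 0 ≤ G y := fun y => indicator_nonneg (fun y _ => by positivity) y
  set ν := (nu n R).prod (volume.restrict (Ioc (0:ℝ) 1)) with hν
  have cm : Measurable (fun p : EE n × ℝ => p.2 • p.1) := by fun_prop
  have hK' : ∀ z, ∫ y in ball z ρ, G y ≤ K := by
    intro z
    rw [hG, setIntegral_indicator (Q_meas n)]
    exact hK z
  have key := avg_trans ν (fun p : EE n × ℝ => p.2 • p.1) cm bG hK' x₀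
  set Φ : EE n → ℝ := fun x => ∫ p, G (x + p.2 • p.1) ∂ν with hΦ
  have Φ0 : ∀ x, 0 ≤ Φ x := fun x => integral_nonneg fun p => G0 _
  have pt : ∀ x ∈ unitCube n, (h x - ∫ y in unitCube n, h y) ^ 2 ≤ R ^ 2 * (R ^ n * om n) * Φ x := by
    intro x hx
    have hc := hh.continuous
    have e1 : h x - ∫ y in unitCube n, h y = ∫ y in unitCube n, (h x - h y) := by
      rw [integral_sub (integrable_const _) (Q_int hc)]; simp
    rw [e1]
    have hc1 : Continuous fun y => (h x - h y) := by fun_prop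
    refine (jensen_int _ (Q_int hc1) (Q_int (hc1.pow 2))).trans ?_
    have e2 : ∫ y in unitCube n, (h x - h y) ^ 2 = ∫ z, (unitCube n).indicator (fun y => (h x - h y) ^ 2) (x + z) := by
      rw [integral_add_left_eq_self (fun z => (unitCube n).indicator (fun y => (h x - h y) ^ 2) z),
        integral_indicator (Q_meas n)]
    have bt : ∀ z, BM (fun t : ℝ => G (x + t • z)) := fun z =>
      bG.comp (by fun_prop : Measurable (fun t : ℝ => x + t • z))
    have bzt : BM (fun p : EE n × ℝ => G (x + p.2 • p.1)) :=
      bG.comp (by fun_prop : Measurable (fun p : EE n × ℝ => x + p.2 • p.1))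
    have bz : BM (fun z => ∫ t in Ioc (0:ℝ) 1, G (x + t • z)) := by
      obtain ⟨C, hC⟩ := bG.2
      refine ⟨bzt.1.stronglyMeasurable.integral_prod_right.measurable, C, fun z => ?_⟩
      have := norm_integral_le_of_norm_le_const (μ := volume.restrict (Ioc (0:ℝ) 1)) (f := fun t => G (x + t • z)) (C := C)
        (Eventually.of_forall fun y => hC _)
      simpa using this
    have e3 : Φ x = (R ^ n * om n)⁻¹ * ∫ z in ball 0 R, ∫ t in Ioc (0:ℝ) 1, G (x + t • z) := by
      rw [hΦ, hν]
      simp only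
      rw [integral_prod _ (bzt.integrable _)]
      have := avg_eq hR0 (fun z : EE n => ∫ t in Ioc (0:ℝ) 1, G (x + t • z)) 0
      simp only [zero_add, avg] at this
      exact this
    rw [e2, e3]
    have e4 : R ^ 2 * (R ^ n * om n) * ((R ^ n * om n)⁻¹ * ∫ z in ball 0 R, ∫ t in Ioc (0:ℝ) 1, G (x + t • z))
        = ∫ z, (ball 0 R).indicator (fun z => R ^ 2 * ∫ t in Ioc (0:ℝ) 1, G (x + t • z)) z := by
      rw [integral_indicator measurableSet_ball, integral_const_mul]
      field_simp
    rw [e4]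
    apply integral_mono
    · exact ((Q_int (hc1.pow 2)).integrable_indicator (Q_meas n)).comp_add_left x
    · exact ((bz.cmul _).iball 0 R).integrable_indicator measurableSet_ball
    intro z
    by_cases hz : x + z ∈ unitCube n
    · have hz2 : z ∈ ball (0 : EE n) R := by
        rw [mem_ball_zero_iff]; simpa using Q_dist hx hz
      simp only [indicator_of_mem hz, indicator_of_mem hz2]
      have := diff_sq hh hx hz
      rwa [sub_sq_comm] at this
    · simp only [indicator_of_notMem hz]
      apply indicator_nonneg
      intro z _
      have := integral_nonneg (μ := volume.restrict (Ioc (0:ℝ) 1)) (f := fun t => G (x + t • z)) fun t => G0 _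
      positivity
  have bΦ : BM Φ := by
    obtain ⟨C, hC⟩ := bG.2
    refine ⟨?_, C, fun z => ?_⟩
    · have : Measurable (fun p : EE n × (EE n × ℝ) => G (p.1 + p.2.2 • p.2.1)) := bG.1.comp (by fun_prop)
      exact this.stronglyMeasurable.integral_prod_right.measurable
    · have := norm_integral_le_of_norm_le_const (μ := ν) (f := fun p => G (z + p.2 • p.1)) (C := C)
        (Eventually.of_forall fun y => hC _)
      simpa using this
  have hcsq : Continuous (fun x => (h x - ∫ y in unitCube n, h y) ^ 2) := by
    have := hh.continuous; fun_prop
  calc ∫ x in ball x₀ ρ ∩ unitCube n, (h x - ∫ y in unitCube n, h y) ^ 2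
      ≤ ∫ x in ball x₀ ρ ∩ unitCube n, R ^ 2 * (R ^ n * om n) * Φ x := by
        apply setIntegral_mono_on ((Q_int hcsq).mono_set inter_subset_right)
          (((bΦ.cmul _).iball x₀ ρ).mono_set inter_subset_left) (measurableSet_ball.inter (Q_meas n))
        intro x hx; exact pt x hx.2
    _ ≤ ∫ x in ball x₀ ρ, R ^ 2 * (R ^ n * om n) * Φ x := by
        apply setIntegral_mono_set ((bΦ.cmul _).iball x₀ ρ) (ae_of_all _ fun x => ?_) inter_subset_left.eventuallyLE
        have := Φ0 x
        simp only [Pi.zero_apply]; positivity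
    _ ≤ _ := by
        rw [integral_const_mul]
        gcongr


lemma div_cube {n : ℕ} (hn : 0 < n) {V : Fin n → EE n → ℝ} (hV : ∀ i, ContDiff ℝ 1 (V i))
    (h0 : ∀ x ∈ unitCube n, ∀ i, (x i = 0 ∨ x i = 1) → V i x = 0) :
    ∫ x in unitCube n, ∑ i, pd i (V i) x = 0 := by
  obtain ⟨m, rfl⟩ : ∃ m, n = m + 1 := ⟨n - 1, by omega⟩
  set L : (Fin (m+1) → ℝ) →L[ℝ] EE (m+1) := (EuclideanSpace.equiv (Fin (m+1)) ℝ).symm.toContinuousLinearMap with hL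
  have hLi : ∀ x, L x = WithLp.toLp 2 x := fun x => rfl
  have e1 : ∫ x in unitCube (m+1), ∑ i, pd i (V i) x
      = ∫ x in Icc (0 : Fin (m+1) → ℝ) 1, ∑ i, pd i (V i) (L x) := by
    rw [Q_eq]
    have := (vp_ofLp (m+1)).setIntegral_preimage_emb
      (MeasurableEquiv.toLp 2 (Fin (m+1) → ℝ)).symm.measurableEmbedding
      (fun x => ∑ i, pd i (V i) (L x)) (Icc 0 1)
    rw [← this]
    rfl
  have hd : ∀ i x, HasFDerivAt (fun x => V i (L x)) ((fderiv ℝ (V i) (L x)).comp L) x := by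
    intro i x
    exact ((hV i).differentiable one_ne_zero _).hasFDerivAt.comp x L.hasFDerivAt
  have e2 : ∀ x, ∑ i, pd i (V i) (L x) = ∑ i, ((fderiv ℝ (V i) (L x)).comp L) (Pi.single i 1) := by
    intro x
    rfl
  have hc : Continuous (fun x => ∑ i, pd i (V i) (L x)) :=
    continuous_finsetSum _ fun i _ => (pd_cont (hV i) i).comp L.continuous
  have key := integral_divergence_of_hasFDerivAt_off_countable' (0 : Fin (m+1) → ℝ) 1 zero_le_one
    (fun i x => V i (L x)) (fun i x => (fderiv ℝ (V i) (L x)).comp L) ∅ countable_empty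
    (fun i => ((hV i).continuous.comp L.continuous).continuousOn) (fun x _ i => hd i x)
    (by simp only [← e2]; exact hc.continuousOn.integrableOn_compact isCompact_Icc)
  rw [e1]
  simp only [e2]
  rw [key]
  apply Finset.sum_eq_zero
  intro i _
  have z : ∀ c : ℝ, (c = 0 ∨ c = 1) → ∫ x in Icc ((0 : Fin (m+1) → ℝ) ∘ i.succAbove) ((1 : Fin (m+1) → ℝ) ∘ i.succAbove),
      V i (L (i.insertNth c x)) = 0 := by
    intro c hc
    apply setIntegral_eq_zero_of_forall_eq_zero
    intro x hx
    apply h0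
    · intro k
      rw [hLi]
      change (i.insertNth c x : Fin (m+1) → ℝ) k ∈ Icc 0 1
      refine Fin.succAboveCases i ?_ (fun k => ?_) k
      · rcases hc with rfl | rfl <;> simp
      · simp only [Fin.insertNth_apply_succAbove]
        exact ⟨hx.1 k, hx.2 k⟩
    · rw [hLi]
      change (i.insertNth c x : Fin (m+1) → ℝ) i = 0 ∨ (i.insertNth c x : Fin (m+1) → ℝ) i = 1
      simpa using hc
  have z0 := z 0 (Or.inl rfl)
  have z1 := z 1 (Or.inr rfl)
  rw [sub_eq_zero]
  exact z1.trans z0.symm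

lemma pd_mul {n : ℕ} {a b : EE n → ℝ} (ha : ContDiff ℝ 1 a) (hb : ContDiff ℝ 1 b) (k : Fin n) (x : EE n) :
    pd k (fun y => a y * b y) x = a x * pd k b x + b x * pd k a x := by
  unfold pd
  rw [fderiv_fun_mul (ha.differentiable one_ne_zero x) (hb.differentiable one_ne_zero x)]
  simp

lemma energy {n : ℕ} (hn : 0 < n) : ∃ C : ℝ, 0 < C ∧ ∀ (u : EE n → ℝ) (F g : Fin n → EE n → ℝ),
    ContDiff ℝ 1 u → (∀ i, ContDiff ℝ 1 (F i)) → (∀ i, Continuous (g i)) →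
    (∀ i x, pd i u x = F i x + g i x) →
    (∀ x ∈ unitCube n, ∀ i, (x i = 0 ∨ x i = 1) → F i x = 0) → (∫ x in unitCube n, u x) = 0 →
    ∫ x in unitCube n, ∑ i, F i x ^ 2 ≤
      C * ((∫ x in unitCube n, ∑ i, g i x ^ 2) + ∫ x in unitCube n, (∑ i, pd i (F i) x) ^ 2) := by
  obtain ⟨Cp, hCp, hP⟩ := lemP n
  refine ⟨3 + 4 * Cp, by positivity, ?_⟩
  intro u F g hu hF hg huF h0 hm
  have cF : ∀ i, Continuous (F i) := fun i => (hF i).continuous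
  have cu := hu.continuous
  have cpu : ∀ i, Continuous (pd i u) := fun i => pd_cont hu i
  have cpF : ∀ i, Continuous (pd i (F i)) := fun i => pd_cont (hF i) i
  set IF := ∫ x in unitCube n, ∑ i, F i x ^ 2 with hIF
  set Ig := ∫ x in unitCube n, ∑ i, g i x ^ 2 with hIg
  set ID := ∫ x in unitCube n, (∑ i, pd i (F i) x) ^ 2 with hID
  have iF := Q_int (h := fun x => ∑ i, F i x ^ 2) (by fun_prop)
  have ig := Q_int (h := fun x => ∑ i, g i x ^ 2) (by fun_prop)
  have iD := Q_int (h := fun x => (∑ i, pd i (F i) x) ^ 2) (by fun_prop)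
  have iu := Q_int (h := fun x => u x ^ 2) (by fun_prop)
  have sub : unitCube n ⊆ ball 0 (n + 1) := fun x hx => by
    rw [mem_ball_zero_iff]; exact Q_norm hx
  have p1 : ∫ x in unitCube n, u x ^ 2 ≤ Cp * (2 * IF + 2 * Ig) := by
    have := hP u hu (n + 1) (2 * IF + 2 * Ig) (fun z => ?_) 0
    · rw [hm, inter_eq_right.2 sub] at this
      simpa using this
    · have ip := Q_int (h := fun x => ∑ k, pd k u x ^ 2) (by fun_prop)
      calc _ ≤ ∫ y in unitCube n, ∑ k, pd k u y ^ 2 :=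
            setIntegral_mono_set ip (ae_of_all _ fun x => by simp only [Pi.zero_apply]; positivity)
              inter_subset_right.eventuallyLE
        _ ≤ ∫ y in unitCube n, (2 * (∑ i, F i y ^ 2) + 2 * ∑ i, g i y ^ 2) := by
            apply setIntegral_mono ip ((iF.const_mul 2).add (ig.const_mul 2))
            intro y
            simp only [Pi.add_apply, Finset.mul_sum, ← Finset.sum_add_distrib]
            refine Finset.sum_le_sum fun i _ => ?_
            rw [huF]
            nlinarith [sq_nonneg (F i y - g i y)]
        _ = _ := by
            rw [integral_add (iF.const_mul 2) (ig.const_mul 2), integral_const_mul, integral_const_mul]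
  have dz := div_cube hn (V := fun i x => F i x * u x) (fun i => (hF i).mul hu)
    (fun x hx i hi => by simp [h0 x hx i hi])
  simp only [pd_mul (hF _) hu, huF] at dz
  set δ : ℝ := 1 / (8 * Cp) with hδ
  have hδ0 : 0 < δ := by positivity
  have p2 : 0 ≤ ∫ x in unitCube n, (-(3 / 4) * (∑ i, F i x ^ 2) + (∑ i, g i x ^ 2) + δ * u x ^ 2
      + 2 * Cp * (∑ i, pd i (F i) x) ^ 2) := by
    have dz' : ∫ x in unitCube n, -(∑ i, (F i x * (F i x + g i x) + u x * pd i (F i) x)) = 0 := by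
      rw [integral_neg, dz, neg_zero]
    rw [← dz']
    apply setIntegral_mono (Q_int (by fun_prop)) (Q_int (by fun_prop))
    intro x
    have h1 : ∑ i, (F i x * (F i x + g i x) + u x * pd i (F i) x) =
        (∑ i, F i x ^ 2) + (∑ i, F i x * g i x) + u x * (∑ i, pd i (F i) x) := by
      rw [Finset.mul_sum, ← Finset.sum_add_distrib, ← Finset.sum_add_distrib]
      exact Finset.sum_congr rfl fun i _ => by ring
    have h2 : 0 ≤ (1/4) * (∑ i, F i x ^ 2) + (∑ i, F i x * g i x) + ∑ i, g i x ^ 2 := by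
      rw [Finset.mul_sum, ← Finset.sum_add_distrib, ← Finset.sum_add_distrib]
      exact Finset.sum_nonneg fun i _ => by nlinarith [sq_nonneg (F i x / 2 + g i x)]
    have h3 : 0 ≤ δ * u x ^ 2 + u x * (∑ i, pd i (F i) x) + 2 * Cp * (∑ i, pd i (F i) x) ^ 2 := by
      have : δ * u x ^ 2 + u x * (∑ i, pd i (F i) x) + 2 * Cp * (∑ i, pd i (F i) x) ^ 2
        = δ * (u x + 4 * Cp * (∑ i, pd i (F i) x)) ^ 2 := by
        rw [hδ]; field_simp; ring
      rw [this]; positivity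
    simp only
    rw [h1]
    linarith
  have p3 : ∫ x in unitCube n, (-(3 / 4) * (∑ i, F i x ^ 2) + (∑ i, g i x ^ 2) + δ * u x ^ 2
      + 2 * Cp * (∑ i, pd i (F i) x) ^ 2) = -(3/4) * IF + Ig + δ * (∫ x in unitCube n, u x ^ 2) + 2 * Cp * ID := by
    rw [integral_add, integral_add, integral_add, integral_const_mul, integral_const_mul, integral_const_mul]
    all_goals exact Q_int (by fun_prop)
  rw [p3] at p2
  have p4 : δ * (∫ x in unitCube n, u x ^ 2) ≤ 1/4 * IF + 1/4 * Ig := by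
    calc _ ≤ δ * (Cp * (2 * IF + 2 * Ig)) := by gcongr
      _ = _ := by rw [hδ]; field_simp; ring
  have g0 : 0 ≤ Ig := integral_nonneg fun x => by simp only [Pi.zero_apply]; positivity
  have d0 : 0 ≤ ID := integral_nonneg fun x => by simp only [Pi.zero_apply]; positivity
  nlinarith [mul_nonneg hCp.le g0]


noncomputable def tau (t : ℝ) : ℝ := |t - 2 * round (t / 2)|

lemma tau_le (t : ℝ) (k : ℤ) : tau t ≤ |t - 2 * k| := by
  have := round_le (t / 2) k
  have e1 : t - 2 * round (t / 2) = 2 * (t / 2 - round (t/2)) := by ring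
  have e2 : t - 2 * k = 2 * (t / 2 - k) := by ring
  rw [tau, e1, e2, abs_mul, abs_mul]
  gcongr

lemma tau_eq {t : ℝ} {k : ℤ} (h : |t - 2 * k| ≤ 1) : tau t = |t - 2 * k| := by
  apply le_antisymm (tau_le t k)
  rw [tau]
  by_cases hk : round (t/2) = k
  · rw [hk]
  · have : (1:ℝ) ≤ |(round (t/2) : ℝ) - k| := by
      have : 1 ≤ |round (t/2) - k| := Int.one_le_abs (sub_ne_zero.2 hk)
      exact_mod_cast this
    have h3 : 2 * |(round (t/2) : ℝ) - k| ≤ |t - 2 * k| + |t - 2 * round (t / 2)| := by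
      have : 2 * |(round (t/2) : ℝ) - k| = |(t - 2 * k) - (t - 2 * round (t/2))| := by
        rw [show (t - 2 * k) - (t - 2 * round (t/2)) = 2 * ((round (t/2) : ℝ) - k) by ring, abs_mul]
        simp
      rw [this]
      exact abs_sub _ _
    linarith

lemma tau_nonneg (t : ℝ) : 0 ≤ tau t := abs_nonneg _

lemma tau_le_one (t : ℝ) : tau t ≤ 1 := by
  have e1 : t - 2 * round (t / 2) = 2 * (t / 2 - round (t/2)) := by ring
  have := abs_sub_round (t / 2)
  rw [tau, e1, abs_mul]
  simp only [Nat.abs_ofNat]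
  linarith

lemma tau_sub (s t : ℝ) : |tau s - tau t| ≤ |s - t| := by
  have key : ∀ s t : ℝ, tau s ≤ tau t + |s - t| := by
    intro s t
    have h := tau_le s (round (t/2))
    have : |s - 2 * round (t/2)| ≤ |t - 2 * round (t/2)| + |s - t| := by
      rw [show s - 2 * (round (t/2) : ℝ) = (t - 2 * round (t/2)) + (s - t) by ring]
      exact abs_add_le _ _
    unfold tau at *
    linarith
  rw [abs_sub_le_iff]
  constructor
  · linarith [key s t]
  · have := key t s
    rw [abs_sub_comm] at this
    linarith

lemma tau_id {t : ℝ} (h : t ∈ Icc (0:ℝ) 1) : tau t = t := by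
  have : |t - 2 * ((0:ℤ):ℝ)| = t := by simp [abs_of_nonneg h.1]
  rw [tau_eq (k := 0) (by rw [this]; exact h.2), this]

lemma tau_even {m : ℤ} (hm : Even m) {t : ℝ} (h : t ∈ Icc (m:ℝ) (m+1)) : tau t = t - m := by
  obtain ⟨k, rfl⟩ := hm
  have h1 := h.1
  have h2 := h.2
  push_cast at *
  have : |t - 2 * (k:ℝ)| = t - (k + k) := by rw [abs_of_nonneg (by linarith)]; ring
  rw [tau_eq (k := k) (by rw [this]; linarith), this]

lemma tau_odd {m : ℤ} (hm : ¬ Even m) {t : ℝ} (h : t ∈ Icc (m:ℝ) (m+1)) : tau t = m + 1 - t := by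
  obtain ⟨k, rfl⟩ := Int.not_even_iff_odd.1 hm
  have h1 := h.1
  have h2 := h.2
  push_cast at *
  have : |t - 2 * ((k+1:ℤ):ℝ)| = 2 * k + 1 + 1 - t := by
    push_cast; rw [abs_of_nonpos (by linarith)]; ring
  rw [tau_eq (k := k+1) (by rw [this]; linarith), this]

lemma tau_int (m : ℤ) : tau m = 0 ∨ tau m = 1 := by
  by_cases hm : Even m
  · left; rw [tau_even hm (by simp)]; simp
  · right; rw [tau_odd hm (by simp)]; simp

open Classical in
noncomputable def sg (t : ℝ) : ℝ := if Even ⌊t⌋ then 1 else -1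

lemma sg_sq (t : ℝ) : sg t * sg t = 1 := by unfold sg; split_ifs <;> norm_num
lemma sg_abs (t : ℝ) : |sg t| = 1 := by unfold sg; split_ifs <;> norm_num

lemma sg_one {t : ℝ} (h : t ∈ Ico (0:ℝ) 1) : sg t = 1 := by
  have : ⌊t⌋ = 0 := Int.floor_eq_zero_iff.2 h
  simp [sg, this]

lemma tau_loc {t : ℝ} {s : ℝ} (h : ⌊s⌋ = ⌊t⌋) : tau s = tau t + sg t * (s - t) ∧ sg s = sg t := by
  constructor
  · have a : s ∈ Icc (⌊t⌋:ℝ) (⌊t⌋+1) := by rw [← h]; exact ⟨Int.floor_le s, (Int.lt_floor_add_one s).le⟩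
    have b : t ∈ Icc (⌊t⌋:ℝ) (⌊t⌋+1) := ⟨Int.floor_le t, (Int.lt_floor_add_one t).le⟩
    unfold sg
    split_ifs with hm
    · rw [tau_even hm a, tau_even hm b]; ring
    · rw [tau_odd hm a, tau_odd hm b]; ring
  · simp [sg, h]

lemma floor_loc {t : ℝ} (h : ∀ m : ℤ, t ≠ m) : ∀ᶠ s in 𝓝 t, ⌊s⌋ = ⌊t⌋ := by
  have : Ioo (⌊t⌋:ℝ) (⌊t⌋+1) ∈ 𝓝 t :=
    Ioo_mem_nhds (lt_of_le_of_ne (Int.floor_le t) (h _).symm) (Int.lt_floor_add_one t)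
  filter_upwards [this] with s hs
  exact Int.floor_eq_iff.2 ⟨hs.1.le, hs.2⟩

lemma sg_ne {s t : ℝ} (h : sg s ≠ sg t) : ∃ m : ℤ, (m:ℝ) ∈ uIcc s t := by
  have hne : ⌊s⌋ ≠ ⌊t⌋ := fun e => h (tau_loc e).2
  rcases lt_or_gt_of_ne hne with h1 | h1
  · refine ⟨⌊t⌋, ?_⟩
    have := Int.floor_lt.1 h1
    exact mem_uIcc.2 (Or.inl ⟨this.le, Int.floor_le t⟩)
  · refine ⟨⌊s⌋, ?_⟩
    have := Int.floor_lt.1 h1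
    exact mem_uIcc.2 (Or.inr ⟨this.le, Int.floor_le s⟩)

lemma tau_cont : Continuous tau := by
  have : LipschitzWith 1 tau := LipschitzWith.of_dist_le_mul fun s t => by
    simpa [Real.dist_eq] using tau_sub s t
  exact this.continuous

lemma map_tau_one (m : ℤ) : (volume.restrict (Ioc (m:ℝ) (m+1))).map tau = volume.restrict (Icc 0 1) := by
  rw [Measure.restrict_congr_set Ioc_ae_eq_Icc]
  by_cases hm : Even m
  · have := (measurePreserving_sub_right (volume : Measure ℝ) (m:ℝ)).restrict_preimage
      (s := Icc (0:ℝ) 1) measurableSet_Icc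
    have e : (fun x : ℝ => x - m) ⁻¹' (Icc (0:ℝ) 1) = Icc (m:ℝ) (m+1) := by
      ext x; simp only [mem_preimage, mem_Icc]; constructor <;> rintro ⟨a, b⟩ <;> constructor <;> linarith
    rw [e] at this
    rw [← this.map_eq]
    apply Measure.map_congr
    filter_upwards [ae_restrict_mem measurableSet_Icc] with t ht
    exact tau_even hm ht
  · have := (Measure.measurePreserving_sub_left (volume : Measure ℝ) ((m:ℝ)+1)).restrict_preimage
      (s := Icc (0:ℝ) 1) measurableSet_Icc
    have e : (fun x : ℝ => (m:ℝ) + 1 - x) ⁻¹' (Icc (0:ℝ) 1) = Icc (m:ℝ) (m+1) := by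
      ext x; simp only [mem_preimage, mem_Icc]; constructor <;> rintro ⟨a, b⟩ <;> constructor <;> linarith
    rw [e] at this
    rw [← this.map_eq]
    apply Measure.map_congr
    filter_upwards [ae_restrict_mem measurableSet_Icc] with t ht
    exact tau_odd hm ht

lemma map_tau_nat (m : ℤ) (N : ℕ) : (volume.restrict (Ioc (m:ℝ) (m+N))).map tau = (N : ENNReal) • volume.restrict (Icc 0 1) := by
  induction N with
  | zero => simp
  | succ N ih =>
    have : Ioc (m:ℝ) (m+(N+1:ℕ)) = Ioc (m:ℝ) (m+N) ∪ Ioc (((m+N:ℤ)):ℝ) ((m+N:ℤ)+1) := by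
      push_cast
      rw [Ioc_union_Ioc_eq_Ioc (by simp) (by simp)]
      ring_nf
    rw [this, Measure.restrict_union _ measurableSet_Ioc, Measure.map_add _ _ tau_cont.measurable, ih, map_tau_one]
    · push_cast
      rw [add_smul, one_smul]
    · push_cast
      exact Ioc_disjoint_Ioc_of_le le_rfl

noncomputable def TT {n : ℕ} (x : EE n) : EE n := WithLp.toLp 2 (fun i => tau (x i))

@[simp] lemma TT_apply {n : ℕ} (x : EE n) (i : Fin n) : TT x i = tau (x i) := rfl

lemma TT_lip {n : ℕ} (x y : EE n) : dist (TT x) (TT y) ≤ dist x y := by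
  rw [EuclideanSpace.dist_eq, EuclideanSpace.dist_eq]
  apply Real.sqrt_le_sqrt
  refine Finset.sum_le_sum fun i _ => ?_
  have := tau_sub (x i) (y i)
  rw [Real.dist_eq, Real.dist_eq]
  simp only [TT_apply]
  gcongr

lemma TT_mem {n : ℕ} (x : EE n) : TT x ∈ unitCube n := fun _ => ⟨tau_nonneg _, tau_le_one _⟩

lemma TT_id {n : ℕ} {x : EE n} (h : x ∈ unitCube n) : TT x = x := by
  ext i; exact tau_id (h i)

lemma TT_cont {n : ℕ} : Continuous (TT : EE n → EE n) := by
  have : LipschitzWith 1 (TT : EE n → EE n) := LipschitzWith.of_dist_le_mul fun s t => by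
    simpa using TT_lip s t
  exact this.continuous

lemma map_pi_tau (n : ℕ) (m : Fin n → ℤ) :
    (volume.restrict (univ.pi fun i => Ioc (m i:ℝ) (m i+(4:ℕ)))).map (fun (x : Fin n → ℝ) i => tau (x i))
      = (4:ENNReal)^n • volume.restrict (Icc (0 : Fin n → ℝ) 1) := by
  rw [volume_pi, Measure.restrict_pi_pi, Measure.pi_map_pi (fun i => tau_cont.measurable.aemeasurable)]
  apply Measure.pi_eq
  intro s hs
  simp only [map_tau_nat]
  have : Icc (0 : Fin n → ℝ) 1 = univ.pi fun i => Icc (0:ℝ) 1 := by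
    ext x; simp [Pi.le_def, forall_and]
  rw [this, Measure.restrict_pi_pi]
  simp [Measure.pi_pi, Finset.prod_mul_distrib]

lemma map_TT (n : ℕ) (m : Fin n → ℤ) :
    (volume.restrict ((WithLp.ofLp : EE n → Fin n → ℝ) ⁻¹' (univ.pi fun i => Ioc (m i:ℝ) (m i+(4:ℕ))))).map TT
      = (4:ENNReal)^n • volume.restrict (unitCube n) := by
  have h1 := ((vp_ofLp n).restrict_preimage (MeasurableSet.univ_pi fun i => (measurableSet_Ioc : MeasurableSet (Ioc (m i:ℝ) (m i+(4:ℕ))))))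
  have h2 : MeasurePreserving (WithLp.toLp 2 : (Fin n → ℝ) → EE n) volume volume := PiLp.volume_preserving_toLp _
  have h3 := h2.restrict_preimage (Q_meas n)
  have e : (WithLp.toLp 2 : (Fin n → ℝ) → EE n) ⁻¹' unitCube n = Icc 0 1 := by
    ext x; simp [unitCube, Pi.le_def, forall_and]
  rw [e] at h3
  rw [← h3.map_eq, ← Measure.map_smul, ← map_pi_tau n m, ← h1.map_eq, Measure.map_map, Measure.map_map]
  · rfl
  all_goals have ht : Measurable (fun (x : Fin n → ℝ) i => tau (x i)) :=
    measurable_pi_lambda _ fun i => tau_cont.measurable.comp (measurable_pi_apply i)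
  · exact h2.measurable.comp ht
  · exact h1.measurable
  · exact h2.measurable
  · exact ht

lemma fold_int {n : ℕ} {h : EE n → ℝ} (hc : Continuous h) (h0 : ∀ x, 0 ≤ h x) (x : EE n) {r : ℝ} (hr : r ≤ 1) :
    ∫ y in ball x r, h (TT y) ≤ 4^n * ∫ y in ball (TT x) r ∩ unitCube n, h y := by
  set m : Fin n → ℤ := fun i => 2 * round (x i / 2) - 2 with hm
  set B := ((WithLp.ofLp : EE n → Fin n → ℝ) ⁻¹' (univ.pi fun i => Ioc (m i:ℝ) (m i+(4:ℕ)))) with hB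
  have hBm : MeasurableSet B := (vp_ofLp n).measurable (MeasurableSet.univ_pi fun i => measurableSet_Ioc)
  have sub : ball x r ⊆ B := by
    intro y hy i _
    have h1 : |y i - x i| < 1 := by
      have := PiLp.norm_apply_le (y - x) i
      rw [mem_ball, dist_eq_norm] at hy
      simp only [PiLp.sub_apply, Real.norm_eq_abs] at this
      linarith
    have h2 : |x i - 2 * round (x i / 2)| ≤ 1 := tau_le_one (x i)
    rw [abs_lt] at h1
    rw [abs_le] at h2
    simp only [hm]
    push_cast
    constructor <;> linarith
  obtain ⟨M, hM⟩ := (ind_BM hc).2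
  have hM' : ∀ y, |h (TT y)| ≤ M := fun y => by
    have := hM (TT y); rwa [indicator_of_mem (TT_mem y)] at this
  set H := (ball (TT x) r).indicator h with hH
  have Hm : Measurable H := hc.measurable.indicator measurableSet_ball
  have vB : volume B ≠ ⊤ := by
    rw [hB, (vp_ofLp n).measure_preimage (MeasurableSet.univ_pi fun i => measurableSet_Ioc).nullMeasurableSet]
    rw [volume_pi_pi]
    exact ENNReal.prod_ne_top fun i _ => by simp
  have H0 : ∀ y, 0 ≤ H y := fun y => indicator_nonneg (fun y _ => h0 y) y
  have iB : IntegrableOn (fun y => H (TT y)) B := by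
    refine Measure.integrableOn_of_bounded (M := M) vB (Hm.comp TT_cont.measurable).aestronglyMeasurable
      (ae_of_all _ fun y => ?_)
    rw [Real.norm_eq_abs, abs_of_nonneg (H0 _)]
    refine le_trans ?_ ((le_abs_self _).trans (hM' y))
    exact indicator_le_self' (fun y _ => h0 y) _
  calc ∫ y in ball x r, h (TT y) = ∫ y in ball x r, H (TT y) := by
        refine setIntegral_congr_fun measurableSet_ball fun y hy => ?_
        simp only [hH]
        rw [indicator_of_mem]
        rw [mem_ball] at hy ⊢
        exact (TT_lip y x).trans_lt hy
    _ ≤ ∫ y in B, H (TT y) := setIntegral_mono_set iB (ae_of_all _ fun y => H0 _) sub.eventuallyLE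
    _ = ∫ y, H y ∂((volume.restrict B).map TT) :=
        (integral_map TT_cont.measurable.aemeasurable Hm.aestronglyMeasurable).symm
    _ = 4^n * ∫ y in unitCube n, H y := by
        rw [hB, map_TT, integral_smul_measure]
        simp
    _ = _ := by
        rw [hH, setIntegral_indicator measurableSet_ball, inter_comm]


noncomputable def Ft {n : ℕ} (F : Fin n → EE n → ℝ) (i : Fin n) (x : EE n) : ℝ := sg (x i) * F i (TT x)

lemma Q_lip {n : ℕ} {h : EE n → ℝ} (hh : ContDiff ℝ 1 h) : ∃ A : NNReal, LipschitzOnWith A h (unitCube n) := by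
  obtain ⟨A, hA⟩ := (Q_compact n).exists_bound_of_continuousOn (hh.continuous_fderiv one_ne_zero).continuousOn
  refine ⟨A.toNNReal, Convex.lipschitzOnWith_of_nnnorm_fderiv_le (𝕜 := ℝ)
    (fun x _ => hh.differentiable one_ne_zero x) (fun x hx => ?_) (Q_convex n)⟩
  rw [← norm_toNNReal]
  exact Real.toNNReal_le_toNNReal (hA x hx)

lemma Ft_lip1 {n : ℕ} {F : Fin n → EE n → ℝ} {i : Fin n} {A : NNReal} (hA : LipschitzOnWith A (F i) (unitCube n))
    (h0 : ∀ x ∈ unitCube n, (x i = 0 ∨ x i = 1) → F i x = 0) : LipschitzWith A (Ft F i) := by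
  have key : ∀ x y : EE n, |F i (TT x) - F i (TT y)| ≤ A * dist x y := by
    intro x y
    have := hA.dist_le_mul _ (TT_mem x) _ (TT_mem y)
    rw [Real.dist_eq] at this
    exact this.trans (by gcongr; exact TT_lip x y)
  refine LipschitzWith.of_dist_le_mul fun x y => ?_
  rw [Real.dist_eq]
  by_cases h : sg (x i) = sg (y i)
  · unfold Ft
    rw [h, ← mul_sub, abs_mul, sg_abs, one_mul]
    exact key x y
  · obtain ⟨m, hm⟩ := sg_ne h
    rw [← segment_eq_uIcc] at hm
    obtain ⟨a, b, ha, hb, hab, e⟩ := hm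
    have hz : F i (TT (a • x + b • y)) = 0 := by
      apply h0 _ (TT_mem _)
      have : TT (a • x + b • y) i = tau m := by
        rw [TT_apply, ← e]; rfl
      rw [this]
      exact tau_int m
    have k1 := key x (a • x + b • y)
    have k2 := key y (a • x + b • y)
    rw [hz, sub_zero] at k1 k2
    have d1 : dist x (a • x + b • y) = b * dist x y := by
      rw [dist_eq_norm, dist_eq_norm, show x - (a • x + b • y) = b • (x - y) by
        rw [show a = 1 - b by linarith]; module, norm_smul, Real.norm_of_nonneg hb]
    have d2 : dist y (a • x + b • y) = a * dist x y := by
      rw [dist_comm x y, dist_eq_norm, dist_eq_norm, show y - (a • x + b • y) = a • (y - x) by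
        rw [show b = 1 - a by linarith]; module, norm_smul, Real.norm_of_nonneg ha]
    rw [d1] at k1
    rw [d2] at k2
    calc |Ft F i x - Ft F i y| ≤ |Ft F i x| + |Ft F i y| := abs_sub _ _
      _ = |F i (TT x)| + |F i (TT y)| := by simp [Ft, abs_mul, sg_abs]
      _ ≤ A * (b * dist x y) + A * (a * dist x y) := add_le_add k1 k2
      _ = A * dist x y * (a + b) := by ring
      _ = _ := by rw [hab, mul_one]

lemma Ft_bdd1 {n : ℕ} {F : Fin n → EE n → ℝ} {i : Fin n} (hF : Continuous (F i)) : ∃ B : NNReal, ∀ x, |Ft F i x| ≤ B := by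
  obtain ⟨B, hB⟩ := (Q_compact n).exists_bound_of_continuousOn hF.continuousOn
  refine ⟨B.toNNReal, fun x => ?_⟩
  rw [Ft, abs_mul, sg_abs, one_mul]
  exact (hB _ (TT_mem x)).trans (Real.le_coe_toNNReal B)

lemma Ft_dd {n : ℕ} {F : Fin n → EE n → ℝ} {i : Fin n} (hF : ContDiff ℝ 1 (F i)) {j : Fin n} {x : EE n}
    (hx : ∀ m : ℤ, x j ≠ m) : dd j (Ft F i) x = sg (x i) * sg (x j) * pd j (F i) (TT x) := by
  have h1 : ∀ᶠ t : ℝ in 𝓝 0, ⌊(x + t • stdVec n j) j⌋ = ⌊x j⌋ := by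
    have hc : Tendsto (fun t : ℝ => (x + t • stdVec n j) j) (𝓝 0) (𝓝 (x j)) := by
      have : Continuous (fun t : ℝ => (x + t • stdVec n j) j) := by fun_prop
      have := this.tendsto 0
      simpa using this
    exact hc.eventually (floor_loc hx)
  have h2 : (fun t : ℝ => Ft F i (x + t • stdVec n j)) =ᶠ[𝓝 0]
      fun t => sg (x i) * F i (TT x + (t * sg (x j)) • stdVec n j) := by
    filter_upwards [h1] with t ht
    have e1 : sg ((x + t • stdVec n j) i) = sg (x i) := by
      by_cases hij : i = j
      · subst hij; exact (tau_loc ht).2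
      · congr 1; simp [stdVec, hij]
    have e2 : TT (x + t • stdVec n j) = TT x + (t * sg (x j)) • stdVec n j := by
      ext k
      by_cases hkj : k = j
      · subst hkj
        have := (tau_loc ht).1
        rw [TT_apply, this]
        simp [stdVec]
        ring
      · simp [stdVec, hkj]
    rw [Ft, e1, e2]
  have hd : HasDerivAt (fun t : ℝ => TT x + (t * sg (x j)) • stdVec n j) (sg (x j) • stdVec n j) 0 := by
    have := (((hasDerivAt_id (0:ℝ)).mul_const (sg (x j))).smul_const (stdVec n j)).const_add (TT x)
    simpa using this
  have hf : HasFDerivAt (F i) (fderiv ℝ (F i) (TT x)) (TT x + ((0:ℝ) * sg (x j)) • stdVec n j) := by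
    have := (hF.differentiable one_ne_zero (TT x)).hasFDerivAt
    simpa using this
  have h3 := ((hf.comp_hasDerivAt 0 hd).const_mul (sg (x i))).congr_of_eventuallyEq h2
  unfold dd lineDeriv
  rw [h3.deriv, map_smul, pd, smul_eq_mul, mul_assoc]

lemma ae_nonint (n : ℕ) : ∀ᵐ x : EE n, ∀ j, ∀ m : ℤ, x j ≠ m := by
  rw [ae_all_iff]; intro j
  rw [ae_all_iff]; intro m
  have : ∀ᵐ x : Fin n → ℝ, x j ≠ m := Measure.ae_eval_ne _ j _
  exact (vp_ofLp n).quasiMeasurePreserving.ae this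

noncomputable def SF {n : ℕ} (F : Fin n → EE n → ℝ) (x : EE n) : ℝ := ∑ i, ∑ j, pd i (F j) x ^ 2
noncomputable def GF {n : ℕ} (F : Fin n → EE n → ℝ) (x : EE n) : ℝ :=
  (∑ j, pd j (F j) x) ^ 2 + ∑ i, ∑ j, (pd i (F j) x - pd j (F i) x) ^ 2

lemma Ft_SS {n : ℕ} {F : Fin n → EE n → ℝ} (hF : ∀ i, ContDiff ℝ 1 (F i)) :
    ∀ᵐ x : EE n, SS (Ft F) x = SF F (TT x) ∧ GG (Ft F) x = GF F (TT x) := by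
  filter_upwards [ae_nonint n] with x hx
  constructor
  · unfold SS SF
    refine Finset.sum_congr rfl fun i _ => Finset.sum_congr rfl fun j _ => ?_
    rw [Ft_dd (hF j) (hx i)]
    linear_combination (sg (x i) * sg (x i) * pd i (F j) (TT x)^2) * sg_sq (x j) + pd i (F j) (TT x)^2 * sg_sq (x i)
  · unfold GG GF
    congr 1
    · congr 1
      refine Finset.sum_congr rfl fun j _ => ?_
      rw [Ft_dd (hF j) (hx j), sg_sq, one_mul]
    · refine Finset.sum_congr rfl fun i _ => Finset.sum_congr rfl fun j _ => ?_
      rw [Ft_dd (hF j) (hx i), Ft_dd (hF i) (hx j)]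
      linear_combination (pd i (F j) (TT x) - pd j (F i) (TT x))^2 * (sg (x i) * sg (x i) * sg_sq (x j) + sg_sq (x i))

lemma fold_main (n : ℕ) {l : ℝ} (hl : l < n) : ∃ C : ℝ, 0 ≤ C ∧ ∀ F : Fin n → EE n → ℝ,
    (∀ i, ContDiff ℝ 1 (F i)) → (∀ x ∈ unitCube n, ∀ i, (x i = 0 ∨ x i = 1) → F i x = 0) →
    ∀ E, (∀ x r, 0 < r → r ≤ 1 → ∫ y in ball x r ∩ unitCube n, GF F y ≤ E * r ^ l) →
    (∫ y in unitCube n, ∑ j, F j y ^ 2 ≤ E) →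
    ∀ x r, 0 < r → r ≤ 1 → ∫ y in ball x r ∩ unitCube n, SF F y ≤ C * E * r ^ l := by
  obtain ⟨K, hK, hA⟩ := thmA n hl
  refine ⟨K * 4^n, by positivity, ?_⟩
  intro F hF h0 E hG hE x r hr hr1
  choose A hA1 using fun i => Q_lip (hF i)
  choose B hB1 using fun i => Ft_bdd1 (F := F) (hF i).continuous
  have cp : ∀ i j, Continuous (pd i (F j)) := fun i j => pd_cont (hF j) i
  have cF : ∀ j, Continuous (F j) := fun j => (hF j).continuous
  have cS : Continuous (SF F) := by unfold SF; fun_prop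
  have cG : Continuous (GF F) := by unfold GF; fun_prop
  have G0 : ∀ x, 0 ≤ GF F x := fun x => by unfold GF; positivity
  have S0 : ∀ x, 0 ≤ SF F x := fun x => by unfold SF; positivity
  have hlip : ∀ j, LipschitzWith (∑ i, A i) (Ft F j) := fun j =>
    (Ft_lip1 (hA1 j) (fun x hx h => h0 x hx j h)).weaken (Finset.single_le_sum (f := A) (fun _ _ => zero_le) (Finset.mem_univ j))
  have hbd : ∀ j x, |Ft F j x| ≤ (∑ i, B i : NNReal) := fun j x =>
    (hB1 j x).trans (by exact_mod_cast (Finset.single_le_sum (f := B) (fun _ _ => zero_le) (Finset.mem_univ j)))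
  have ae := Ft_SS hF
  have hMB : MB l (GG (Ft F)) (4^n * E) := by
    intro x r hr hr1
    calc ∫ y in ball x r, GG (Ft F) y = ∫ y in ball x r, GF F (TT y) :=
          integral_congr_ae (ae_restrict_of_ae (ae.mono fun y hy => hy.2))
      _ ≤ 4^n * ∫ y in ball (TT x) r ∩ unitCube n, GF F y := fold_int cG G0 x hr1
      _ ≤ 4^n * (E * r ^ l) := by gcongr; exact hG _ _ hr hr1
      _ = _ := by ring
  have hE' : ∀ x, ∫ y in ball x 1, ∑ j, Ft F j y ^ 2 ≤ 4^n * E := by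
    intro x
    have e : ∀ y, ∑ j, Ft F j y ^ 2 = (fun z => ∑ j, F j z ^ 2) (TT y) := fun y => by
      refine Finset.sum_congr rfl fun j _ => ?_
      rw [Ft, mul_pow, pow_two (sg _), sg_sq, one_mul]
    simp only [e]
    refine (fold_int (h := fun z => ∑ j, F j z ^ 2) (by fun_prop) (fun x => by positivity) x le_rfl).trans ?_
    gcongr
    refine le_trans ?_ hE
    exact setIntegral_mono_set (Q_int (by fun_prop)) (ae_of_all _ fun x => by simp only [Pi.zero_apply]; positivity)
              inter_subset_right.eventuallyLE
  have fin := hA (Ft F) _ _ hlip hbd _ hMB hE' x r hr hr1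
  calc ∫ y in ball x r ∩ unitCube n, SF F y = ∫ y in ball x r ∩ unitCube n, SS (Ft F) y := by
        refine setIntegral_congr_ae (measurableSet_ball.inter (Q_meas n)) (ae.mono fun y hy hm => ?_)
        rw [hy.1, TT_id hm.2]
    _ ≤ ∫ y in ball x r, SS (Ft F) y :=
        setIntegral_mono_set ((SS_BM hlip).integrableOn measure_ball_lt_top.ne) (ae_of_all _ fun x => SS_nonneg _ x)
              inter_subset_left.eventuallyLE
    _ ≤ _ := fin.trans_eq (by ring)


def Mo {n : ℕ} (l : ℝ) (h : EE n → ℝ) (A : ℝ) : Prop :=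
  ∀ x r, 0 < r → r ≤ 1 → ∫ y in ball x r ∩ unitCube n, h y ≤ A * r ^ l

lemma Q_intb {n : ℕ} {h : EE n → ℝ} (hh : Continuous h) (x : EE n) (r : ℝ) :
    IntegrableOn h (ball x r ∩ unitCube n) := (Q_int hh).mono_set inter_subset_right

lemma Mo_lin {n : ℕ} {l : ℝ} {h h1 h2 : EE n → ℝ} {a b A B : ℝ} (ha : 0 ≤ a) (hb : 0 ≤ b)
    (c : Continuous h) (c1 : Continuous h1) (c2 : Continuous h2)
    (hle : ∀ᵐ y, y ∈ unitCube n → h y ≤ a * h1 y + b * h2 y) (m1 : Mo l h1 A) (m2 : Mo l h2 B) :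
    Mo l h (a * A + b * B) := by
  intro x r hr hr1
  have i1 := Q_intb c1 x r
  have i2 := Q_intb c2 x r
  calc ∫ y in ball x r ∩ unitCube n, h y ≤ ∫ y in ball x r ∩ unitCube n, (a * h1 y + b * h2 y) := by
        refine setIntegral_mono_on_ae (Q_intb c x r) ((i1.const_mul a).add (i2.const_mul b))
          (measurableSet_ball.inter (Q_meas n)) ?_
        exact hle.mono fun y hy hm => hy hm.2
    _ = a * (∫ y in ball x r ∩ unitCube n, h1 y) + b * ∫ y in ball x r ∩ unitCube n, h2 y := by
        rw [integral_add (i1.const_mul a) (i2.const_mul b), integral_const_mul, integral_const_mul]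
    _ ≤ a * (A * r ^ l) + b * (B * r ^ l) := by
        gcongr
        · exact m1 x r hr hr1
        · exact m2 x r hr hr1
    _ = _ := by ring

lemma Mo_sum {n : ℕ} {l : ℝ} {h : Fin n → EE n → ℝ} {A : ℝ} (c : ∀ j, Continuous (h j))
    (m : ∀ j, Mo l (h j) A) : Mo l (fun y => ∑ j, h j y) (n * A) := by
  intro x r hr hr1
  rw [integral_finsetSum _ fun j _ => Q_intb (c j) x r]
  calc _ ≤ ∑ j : Fin n, A * r ^ l := Finset.sum_le_sum fun j _ => m j x r hr hr1
    _ = _ := by simp; ring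

lemma Mo_const {n : ℕ} {l : ℝ} (hl : l < n) {a : ℝ} (ha : 0 ≤ a) : Mo (n := n) l (fun _ => a) (om n * a) := by
  intro x r hr hr1
  rw [setIntegral_const, smul_eq_mul]
  have h1 : volume.real (ball x r ∩ unitCube n) ≤ r ^ n * om n := by
    rw [← vol_ball x hr]
    exact measureReal_mono inter_subset_left measure_ball_lt_top.ne
  have h2 : r ^ n ≤ r ^ l := by
    rw [← Real.rpow_natCast]
    exact Real.rpow_le_rpow_of_exponent_ge hr hr1 hl.le
  have := om_pos n
  calc _ ≤ r ^ n * om n * a := by gcongr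
    _ ≤ r ^ l * om n * a := by gcongr
    _ = _ := by ring

lemma Mo_Q (n : ℕ) : ∃ N : ℝ, 0 ≤ N ∧ ∀ (l : ℝ) (h : EE n → ℝ) (A : ℝ), Continuous h → (∀ x, 0 ≤ h x) → Mo l h A →
    ∫ y in unitCube n, h y ≤ N * A := by
  obtain ⟨N, hN, H⟩ := cover_int n (n + 1)
  refine ⟨N, by positivity, fun l h A hc h0 hm => ?_⟩
  have := H _ (ind_BM hc) (fun x => indicator_nonneg (fun y _ => h0 y) x) 1 one_pos A (fun z => ?_) 0
  · rw [mul_one, setIntegral_indicator (Q_meas n), inter_eq_right.2] at this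
    · exact this
    · intro x hx
      rw [mem_ball_zero_iff]; exact Q_norm hx
  · rw [setIntegral_indicator (Q_meas n)]
    simpa using hm z 1 one_pos le_rfl

lemma phi_eq {α I r : ℝ} (hr : 0 < r) : r ^ α * I ^ ((1:ℝ)/2) = √(r ^ (2 * α) * I) := by
  rw [Real.sqrt_mul (by positivity), Real.sqrt_eq_rpow, ← Real.rpow_mul hr.le, Real.sqrt_eq_rpow]
  congr 2
  ring

lemma norm_int {n : ℕ} (h : EE n → ℝ) (s : Set (EE n)) : ∫ y in s, |h y| ^ (2:ℝ) = ∫ y in s, h y ^ 2 := by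
  simp

lemma N2 {n : ℕ} {q A : ℝ} {h : EE n → ℝ} (hA : 0 ≤ A)
    (m : Mo (n - 2 * n / q) (fun y => h y ^ 2) (A ^ 2)) : morreyNorm n q 2 (unitCube n) h ≤ A := by
  unfold morreyNorm
  have : Nonempty (Set.Ioc (0:ℝ) 1) := ⟨⟨1, by simp⟩⟩
  refine ciSup_le fun x => ciSup_le fun r => ?_
  rw [phi_eq r.2.1, norm_int]
  apply Real.sqrt_le_iff.2 ⟨hA, ?_⟩
  have h1 := m x r r.2.1 r.2.2
  have hr := r.2.1
  calc _ ≤ (r:ℝ) ^ (2 * ((n:ℝ) * (1 / q - 1 / 2))) * (A ^ 2 * (r:ℝ) ^ ((n:ℝ) - 2 * n / q)) := by gcongr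
    _ = A ^ 2 * ((r:ℝ) ^ (2 * ((n:ℝ) * (1 / q - 1 / 2))) * (r:ℝ) ^ ((n:ℝ) - 2 * n / q)) := by ring
    _ = A ^ 2 := by
      rw [← Real.rpow_add hr, show 2 * ((n:ℝ) * (1 / q - 1 / 2)) + ((n:ℝ) - 2 * n / q) = 0 by ring]
      simp

lemma N0 {n : ℕ} {q : ℝ} {h : EE n → ℝ} : 0 ≤ morreyNorm n q 2 (unitCube n) h := by
  unfold morreyNorm
  refine Real.iSup_nonneg fun x => Real.iSup_nonneg fun r => ?_
  have hr := r.2.1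
  rw [phi_eq hr]
  positivity

lemma N1 {n : ℕ} {q : ℝ} (hn : 0 < n) (hq : 0 < q) {h : EE n → ℝ} (hc : Continuous h) :
    Mo (n - 2 * n / q) (fun y => h y ^ 2) (morreyNorm n q 2 (unitCube n) h ^ 2) := by
  have hl : (n:ℝ) - 2 * n / q < n := by
    have : 0 < 2 * (n:ℝ) / q := by positivity
    linarith
  obtain ⟨M, hM⟩ := (Q_compact n).exists_bound_of_continuousOn hc.continuousOn
  have mb : Mo (n - 2 * n / q) (fun y => h y ^ 2) (1 * (om n * M^2) + 0 * (om n * M^2)) := by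
    refine Mo_lin zero_le_one le_rfl (by fun_prop) continuous_const continuous_const ?_
      (Mo_const hl (sq_nonneg M)) (Mo_const hl (sq_nonneg M))
    refine ae_of_all _ fun y hy => ?_
    have := hM y hy
    rw [Real.norm_eq_abs] at this
    have h2 : h y ^ 2 ≤ M ^ 2 := sq_le_sq' (by linarith [neg_abs_le (h y)]) ((le_abs_self _).trans this)
    linarith
  set B := 1 * (om n * M^2) + 0 * (om n * M^2) with hB
  have hB0 : 0 ≤ B := by have := om_pos n; positivity
  have key : ∀ (x : EE n) (r : Set.Ioc (0:ℝ) 1), (r : ℝ) ^ ((n : ℝ) * (1/q - 1/2)) *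
      (∫ y in Metric.ball x (r : ℝ) ∩ unitCube n, |h y| ^ (2:ℝ)) ^ ((1:ℝ)/2) ≤ √B := by
    intro x r
    rw [phi_eq r.2.1, norm_int]
    apply Real.sqrt_le_sqrt
    have h1 := mb x r r.2.1 r.2.2
    have hr := r.2.1
    calc _ ≤ (r:ℝ) ^ (2 * ((n:ℝ) * (1 / q - 1 / 2))) * (B * (r:ℝ) ^ ((n:ℝ) - 2 * n / q)) := by gcongr
      _ = B * ((r:ℝ) ^ (2 * ((n:ℝ) * (1 / q - 1 / 2))) * (r:ℝ) ^ ((n:ℝ) - 2 * n / q)) := by ring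
      _ = B := by
        rw [← Real.rpow_add hr, show 2 * ((n:ℝ) * (1 / q - 1 / 2)) + ((n:ℝ) - 2 * n / q) = 0 by ring]
        simp
  have : Nonempty (Set.Ioc (0:ℝ) 1) := ⟨⟨1, by simp⟩⟩
  intro x r hr hr1
  have le : (r : ℝ) ^ ((n : ℝ) * (1/q - 1/2)) *
      (∫ y in Metric.ball x (r : ℝ) ∩ unitCube n, |h y| ^ (2:ℝ)) ^ ((1:ℝ)/2) ≤ morreyNorm n q 2 (unitCube n) h := by
    unfold morreyNorm
    refine le_trans ?_ (le_ciSup (f := fun x₀ : EuclideanSpace ℝ (Fin n) => ⨆ r : Set.Ioc (0:ℝ) 1,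
      (r : ℝ) ^ ((n : ℝ) * (1/q - 1/2)) *
      (∫ y in Metric.ball x₀ (r : ℝ) ∩ unitCube n, |h y| ^ (2:ℝ)) ^ ((1:ℝ)/2)) ⟨√B, ?_⟩ x)
    · exact le_ciSup (f := fun r : Set.Ioc (0:ℝ) 1 => (r : ℝ) ^ ((n : ℝ) * (1/q - 1/2)) *
        (∫ y in Metric.ball x (r : ℝ) ∩ unitCube n, |h y| ^ (2:ℝ)) ^ ((1:ℝ)/2))
        ⟨√B, by rintro _ ⟨r, rfl⟩; exact key x r⟩ ⟨r, hr, hr1⟩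
    · rintro _ ⟨x, rfl⟩
      exact ciSup_le (key x)
  rw [phi_eq hr, norm_int] at le
  set N := morreyNorm n q 2 (unitCube n) h with hN
  have h1 := (Real.sqrt_le_iff.1 le).2
  have e : (r:ℝ) ^ ((n:ℝ) - 2 * n / q) * (r:ℝ) ^ (2 * ((n:ℝ) * (1 / q - 1 / 2))) = 1 := by
    rw [← Real.rpow_add hr, show ((n:ℝ) - 2 * n / q) + 2 * ((n:ℝ) * (1 / q - 1 / 2)) = 0 by ring]
    simp
  calc ∫ y in ball x r ∩ unitCube n, h y ^ 2
      = (r:ℝ) ^ ((n:ℝ) - 2 * n / q) * ((r:ℝ) ^ (2 * ((n:ℝ) * (1 / q - 1 / 2))) * ∫ y in ball x r ∩ unitCube n, h y ^ 2) := by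
        rw [← mul_assoc, e, one_mul]
    _ ≤ (r:ℝ) ^ ((n:ℝ) - 2 * n / q) * N ^ 2 := by gcongr
    _ = _ := by ring

lemma op_sq {n : ℕ} {V : Type*} [NormedAddCommGroup V] [NormedSpace ℝ V] (L : EE n →L[ℝ] V) :
    ‖L‖ ^ 2 ≤ ∑ k, ‖L (stdVec n k)‖ ^ 2 := by
  have h : ‖L‖ ≤ √(∑ k, ‖L (stdVec n k)‖ ^ 2) := by
    refine L.opNorm_le_bound (Real.sqrt_nonneg _) fun v => ?_
    conv_lhs => rw [sum_stdVec v]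
    rw [map_sum]
    calc _ ≤ ∑ k, ‖L (stdVec n k)‖ * |v k| := by
          refine (norm_sum_le _ _).trans (Finset.sum_le_sum fun k _ => ?_)
          rw [map_smul, norm_smul, Real.norm_eq_abs, mul_comm]
      _ ≤ √(∑ k, ‖L (stdVec n k)‖ ^ 2) * √(∑ k, |v k| ^ 2) := Real.sum_mul_le_sqrt_mul_sqrt _ _ _
      _ = _ := by rw [EuclideanSpace.norm_eq]; simp
  calc _ ≤ (√(∑ k, ‖L (stdVec n k)‖ ^ 2)) ^ 2 := by gcongr
    _ = _ := Real.sq_sqrt (by positivity)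

lemma pd_le {n : ℕ} (h : EE n → ℝ) (k : Fin n) (x : EE n) : pd k h x ^ 2 ≤ ‖fderiv ℝ h x‖ ^ 2 := by
  have : |pd k h x| ≤ ‖fderiv ℝ h x‖ := by
    have := (fderiv ℝ h x).le_opNorm (stdVec n k)
    rwa [norm_stdVec, mul_one] at this
  rw [← sq_abs]
  gcongr

lemma pd_pd {n : ℕ} {u : EE n → ℝ} (hu : ContDiff ℝ 2 u) (i j : Fin n) (x : EE n) :
    pd i (pd j u) x = fderiv ℝ (fderiv ℝ u) x (stdVec n i) (stdVec n j) := by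
  have hd : DifferentiableAt ℝ (fderiv ℝ u) x :=
    (hu.fderiv_right (m := 1) (by norm_num)).differentiable one_ne_zero x
  have := hd.hasFDerivAt.clm_apply (hasFDerivAt_const (stdVec n j) x)
  unfold pd
  rw [this.fderiv]
  simp

lemma pd_symm {n : ℕ} {u : EE n → ℝ} (hu : ContDiff ℝ 2 u) (i j : Fin n) (x : EE n) :
    pd i (pd j u) x = pd j (pd i u) x := by
  rw [pd_pd hu, pd_pd hu]
  exact (hu.contDiffAt.isSymmSndFDerivAt (by simp)).eq _ _

lemma hess_le {n : ℕ} {u : EE n → ℝ} (hu : ContDiff ℝ 2 u) (x : EE n) :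
    ‖iteratedFDeriv ℝ 2 u x‖ ^ 2 ≤ ∑ i, ∑ j, pd i (pd j u) x ^ 2 := by
  have e : ‖iteratedFDeriv ℝ 2 u x‖ = ‖fderiv ℝ (fderiv ℝ u) x‖ := by
    rw [← norm_iteratedFDeriv_fderiv (n := 1), norm_iteratedFDeriv_one]
  rw [e]
  refine (op_sq _).trans (Finset.sum_le_sum fun i _ => (op_sq _).trans (Finset.sum_le_sum fun j _ => ?_))
  rw [pd_pd hu, Real.norm_eq_abs, sq_abs]


lemma pd_sub {n : ℕ} {a b : EE n → ℝ} (ha : ContDiff ℝ 1 a) (hb : ContDiff ℝ 1 b) (k : Fin n) (x : EE n) :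
    pd k (fun y => a y - b y) x = pd k a x - pd k b x := by
  unfold pd
  rw [fderiv_fun_sub (ha.differentiable one_ne_zero x) (hb.differentiable one_ne_zero x)]
  rfl

lemma GF_pt {n : ℕ} {u f : EE n → ℝ} {g : Fin n → EE n → ℝ} (hu : ContDiff ℝ 2 u)
    (hg : ∀ i, ContDiff ℝ 1 (g i)) {x : EE n} (hx : lapl n u x = f x) :
    GF (fun i y => pd i u y - g i y) x ≤ 2 * f x ^ 2 + 6 * n * ∑ b, ‖fderiv ℝ (g b) x‖ ^ 2 := by
  have hp : ∀ j, ContDiff ℝ 1 (pd j u) := fun j =>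
    (hu.fderiv_right (m := 1) (by norm_num)).clm_apply contDiff_const
  unfold GF
  simp only [pd_sub (hp _) (hg _)]
  have e1 : ∑ j, (pd j (pd j u) x - pd j (g j) x) = f x - ∑ j, pd j (g j) x := by
    rw [Finset.sum_sub_distrib, ← hx]; rfl
  rw [e1]
  set G := ∑ b, ‖fderiv ℝ (g b) x‖ ^ 2 with hG
  have h1 : (∑ j, pd j (g j) x) ^ 2 ≤ n * G := by
    refine sq_sum_le_card_mul_sum_sq.trans ?_
    simp only [Finset.card_univ, Fintype.card_fin]
    gcongr
    exact Finset.sum_le_sum fun j _ => pd_le _ _ _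
  have h2 : ∑ i, ∑ j, (pd i (pd j u) x - pd i (g j) x - (pd j (pd i u) x - pd j (g i) x)) ^ 2 ≤ 4 * (n * G) := by
    calc _ ≤ ∑ i, ∑ j, (2 * ‖fderiv ℝ (g j) x‖ ^ 2 + 2 * ‖fderiv ℝ (g i) x‖ ^ 2) := by
          refine Finset.sum_le_sum fun i _ => Finset.sum_le_sum fun j _ => ?_
          rw [pd_symm hu i j]
          have a := pd_le (g j) i x
          have b := pd_le (g i) j x
          nlinarith [sq_nonneg (pd i (g j) x + pd j (g i) x)]
      _ = _ := by
          simp only [Finset.sum_add_distrib, ← Finset.mul_sum, Finset.sum_const, Finset.card_univ, Fintype.card_fin, nsmul_eq_mul, ← hG]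
          ring
  nlinarith [sq_nonneg (f x + ∑ j, pd j (g j) x)]

lemma final_thm (n : ℕ) (hn : 0 < n) (q : ℝ) (hq : 0 < q) :
    ∃ C : ℝ, 0 ≤ C ∧ ∀ (u f : EE n → ℝ) (g : Fin n → EE n → ℝ),
      ContDiff ℝ 2 u → Continuous f → (∀ β, ContDiff ℝ 1 (g β)) →
      (∀ x ∈ openUnitCube n, lapl n u x = f x) →
      (∀ x ∈ unitCube n, ∀ β, (x β = 0 ∨ x β = 1) → pd β u x = g β x) →
      (∫ x in unitCube n, u x) = 0 → ∀ N : ℝ, 0 ≤ N →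
      Mo (n - 2 * n / q) (fun x => f x ^ 2) (N ^ 2) →
      Mo (n - 2 * n / q) (fun x => ∑ b, g b x ^ 2) (N ^ 2) →
      Mo (n - 2 * n / q) (fun x => ∑ b, ‖fderiv ℝ (g b) x‖ ^ 2) (N ^ 2) →
      Mo (n - 2 * n / q) (fun x => u x ^ 2) (C * N ^ 2) ∧
      Mo (n - 2 * n / q) (fun x => ‖fderiv ℝ u x‖ ^ 2) (C * N ^ 2) ∧
      Mo (n - 2 * n / q) (fun x => ‖iteratedFDeriv ℝ 2 u x‖ ^ 2) (C * N ^ 2) := by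
  have hl : (n:ℝ) - 2 * n / q < n := by
    have : 0 < 2 * (n:ℝ) / q := by positivity
    linarith
  set l := (n:ℝ) - 2 * n / q with hl_def
  obtain ⟨K, hK, fold⟩ := fold_main n hl
  obtain ⟨Ce, hCe, hen⟩ := energy hn
  obtain ⟨Cp, hCp, hP⟩ := lemP n
  obtain ⟨Nc, hNc, hQ⟩ := Mo_Q n
  have ho := om_pos n
  set cG : ℝ := 2 + 6 * n with hcG
  set cE : ℝ := cG + Ce * (Nc + Nc * cG) with hcE
  set cF : ℝ := n * (2 * (Cp * (K * cE)) + 2 * (om n * cE)) with hcF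
  set c1 : ℝ := 2 * cF + 2 with hc1
  set c2 : ℝ := 2 * (K * cE) + 2 * n with hc2
  have cG0 : 0 ≤ cG := by positivity
  have cE0 : 0 ≤ cE := by positivity
  have cF0 : 0 ≤ cF := by positivity
  have c10 : 0 ≤ c1 := by positivity
  have c20 : 0 ≤ c2 := by positivity
  refine ⟨Cp * c1 + c1 + c2, by positivity, ?_⟩
  intro u f g hu hf hg hlap hbc hmean N hN mf mg mdg
  have mono : ∀ {h : EE n → ℝ} {A B : ℝ}, Mo l h A → A ≤ B → Mo l h B := by
    intro h A B hm hAB x r hr hr1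
    exact (hm x r hr hr1).trans (by gcongr)
  have hu1 : ContDiff ℝ 1 u := hu.of_le (by norm_num)
  have hp : ∀ j, ContDiff ℝ 1 (pd j u) := fun j =>
    (hu.fderiv_right (m := 1) (by norm_num)).clm_apply contDiff_const
  have hFd : ∀ i, ContDiff ℝ 1 (fun y => pd i u y - g i y) := fun i => (hp i).sub (hg i)
  have cdg : ∀ b, Continuous (fderiv ℝ (g b)) := fun b => (hg b).continuous_fderiv one_ne_zero
  have cg : ∀ b, Continuous (g b) := fun b => (hg b).continuous
  have cp : ∀ b, Continuous (pd b u) := fun b => (hp b).continuous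
  have cpp : ∀ a b, Continuous (pd a (pd b u)) := fun a b => pd_cont (hp b) a
  have cu := hu.continuous
  have cdu := hu1.continuous_fderiv one_ne_zero
  have cddu : Continuous (fun x => iteratedFDeriv ℝ 2 u x) := hu.continuous_iteratedFDeriv (by norm_num)
  obtain ⟨F, hF⟩ : ∃ F : Fin n → EE n → ℝ, F = fun i y => pd i u y - g i y := ⟨_, rfl⟩
  have hF1 : ∀ i, ContDiff ℝ 1 (F i) := by rw [hF]; exact hFd
  have cF' : ∀ i, Continuous (F i) := fun i => (hF1 i).continuous
  have cpF : ∀ i j, Continuous (pd i (F j)) := fun i j => pd_cont (hF1 j) i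
  have cSF : Continuous (SF F) := by unfold SF; fun_prop
  have cGF : Continuous (GF F) := by unfold GF; fun_prop
  have G0 : ∀ x, 0 ≤ GF F x := fun x => by unfold GF; positivity
  have mG : Mo l (GF F) (cG * N ^ 2) := by
    have := Mo_lin (a := 2) (b := 6 * n) (by norm_num) (by positivity) cGF
      (h1 := fun x => f x ^ 2) (h2 := fun x => ∑ b, ‖fderiv ℝ (g b) x‖ ^ 2) (by fun_prop) (by fun_prop) ?_ mf mdg
    · exact mono this (le_of_eq (by rw [hcG]; ring))
    · filter_upwards [ae_nonint n] with y hy hm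
      rw [hF]
      apply GF_pt hu hg
      apply hlap
      intro i
      have h0 := hy i 0
      have h1 := hy i 1
      push_cast at h0 h1
      exact ⟨lt_of_le_of_ne (hm i).1 h0.symm, lt_of_le_of_ne (hm i).2 h1⟩
  have F0 : ∀ x ∈ unitCube n, ∀ i, (x i = 0 ∨ x i = 1) → F i x = 0 := by
    intro x hx i h
    rw [hF]
    simp only
    rw [hbc x hx i h, sub_self]
  have en := hen u F g hu1 hF1 cg (fun i x => by rw [hF]; ring) F0 hmean
  have hD : ∫ x in unitCube n, (∑ i, pd i (F i) x) ^ 2 ≤ Nc * (cG * N ^ 2) := by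
    refine le_trans ?_ (hQ l _ _ cGF G0 mG)
    refine setIntegral_mono (Q_int (by fun_prop)) (Q_int cGF) fun x => ?_
    simp only [GF]
    have : 0 ≤ ∑ i, ∑ j, (pd i (F j) x - pd j (F i) x) ^ 2 := by positivity
    linarith
  have hg2 := hQ l _ _ (by fun_prop) (fun x => by positivity) mg
  have hE : ∫ y in unitCube n, ∑ j, F j y ^ 2 ≤ cE * N ^ 2 := by
    calc _ ≤ Ce * (Nc * N ^ 2 + Nc * (cG * N ^ 2)) := en.trans (by gcongr)
      _ ≤ cE * N ^ 2 := by
        have : 0 ≤ cG * N ^ 2 := by positivity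
        rw [hcE]; linarith
  have mG' : Mo l (GF F) (cE * N ^ 2) := mono mG (by
    have : 0 ≤ Ce * (Nc + Nc * cG) := by positivity
    gcongr; rw [hcE]; linarith)
  have mS : Mo l (SF F) (K * (cE * N ^ 2)) := fold F hF1 F0 _ mG' hE
  have mF1 : ∀ j, Mo l (fun y => F j y ^ 2) (2 * (Cp * (K * (cE * N ^ 2))) + 2 * (om n * (cE * N ^ 2))) := by
    intro j
    set m := ∫ y in unitCube n, F j y with hm
    have hm2 : m ^ 2 ≤ cE * N ^ 2 := by
      refine (jensen_int _ (Q_int (cF' j)) (Q_int (by fun_prop))).trans (le_trans ?_ hE)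
      refine setIntegral_mono (Q_int (by fun_prop)) (Q_int (by fun_prop)) fun x => ?_
      exact Finset.single_le_sum (f := fun j => F j x ^ 2) (fun _ _ => sq_nonneg _) (Finset.mem_univ j)
    have a1 : Mo l (fun y => (F j y - m) ^ 2) (Cp * (K * (cE * N ^ 2))) := by
      intro x r hr hr1
      have := hP (F j) (hF1 j) r (K * (cE * N ^ 2) * r ^ l) (fun z => ?_) x
      · rw [mul_assoc Cp]; exact this
      · refine le_trans ?_ (mS z r hr hr1)
        refine setIntegral_mono (Q_intb (by fun_prop) _ _) (Q_intb cSF _ _) fun y => ?_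
        unfold SF
        refine Finset.sum_le_sum fun k _ => ?_
        exact Finset.single_le_sum (f := fun j => pd k (F j) y ^ 2) (fun _ _ => sq_nonneg _) (Finset.mem_univ j)
    have a2 : Mo (n := n) l (fun _ => m ^ 2) (om n * (cE * N ^ 2)) := mono (Mo_const hl (sq_nonneg m)) (by gcongr)
    refine Mo_lin (by norm_num) (by norm_num) (by fun_prop) (by fun_prop) (by fun_prop) (ae_of_all _ fun y _ => ?_) a1 a2
    nlinarith [sq_nonneg (F j y - 2 * m)]
  have mF := Mo_sum (h := fun j y => F j y ^ 2) (fun j => (cF' j).pow 2) mF1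
  have mp : Mo l (fun y => ∑ j, pd j u y ^ 2) (c1 * N ^ 2) := by
    have := Mo_lin (a := 2) (b := 2) (h := fun y => ∑ j, pd j u y ^ 2) (by norm_num) (by norm_num) (by fun_prop) (by fun_prop) (by fun_prop) (ae_of_all _ fun y _ => ?_) mF mg
    · exact mono this (le_of_eq (by rw [hc1, hcF]; ring))
    · simp only [Finset.mul_sum, ← Finset.sum_add_distrib]
      refine Finset.sum_le_sum fun j _ => ?_
      have : pd j u y = F j y + g j y := by rw [hF]; ring
      rw [this]
      nlinarith [sq_nonneg (F j y - g j y)]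
  have t0 : 0 ≤ c1 * N ^ 2 := by positivity
  have t1 : 0 ≤ Cp * c1 * N ^ 2 := by positivity
  have t2 : 0 ≤ c2 * N ^ 2 := by positivity
  refine ⟨?_, ?_, ?_⟩
  · refine mono (A := Cp * (c1 * N ^ 2)) ?_ (by linarith)
    intro x r hr hr1
    have := hP u hu1 r (c1 * N ^ 2 * r ^ l) (fun z => mp z r hr hr1) x
    rw [hmean] at this
    simp only [sub_zero] at this
    rw [mul_assoc Cp]; exact this
  · have := Mo_lin (a := 1) (b := 0) (h := fun x => ‖fderiv ℝ u x‖ ^ 2) (by norm_num) le_rfl (by fun_prop) (by fun_prop) (by fun_prop) (ae_of_all _ fun y _ => ?_) mp mp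
    · exact mono this (by linarith)
    · have := op_sq (fderiv ℝ u y)
      simp only [Real.norm_eq_abs, sq_abs] at this
      rw [one_mul, zero_mul, add_zero]
      exact this
  · have := Mo_lin (a := 2) (b := 2 * n) (h := fun x => ‖iteratedFDeriv ℝ 2 u x‖ ^ 2) (by norm_num) (by positivity) (by fun_prop) cSF (h2 := fun x => ∑ b, ‖fderiv ℝ (g b) x‖ ^ 2) (by fun_prop) (ae_of_all _ fun y _ => ?_) mS mdg
    · exact mono this (by rw [hc2] at t2 ⊢; linarith)
    · refine (hess_le hu y).trans ?_
      have e : 2 * SF F y + 2 * n * ∑ b, ‖fderiv ℝ (g b) y‖ ^ 2 = ∑ i, ∑ j, (2 * pd i (F j) y ^ 2 + 2 * ‖fderiv ℝ (g j) y‖ ^ 2) := by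
        simp only [SF, Finset.sum_add_distrib, ← Finset.mul_sum, Finset.sum_const, Finset.card_univ, Fintype.card_fin, nsmul_eq_mul]
        ring
      rw [e]
      refine Finset.sum_le_sum fun i _ => Finset.sum_le_sum fun j _ => ?_
      have e2 : pd i (pd j u) y = pd i (F j) y + pd i (g j) y := by
        rw [hF]
        simp only [pd_sub (hp j) (hg j)]
        ring
      rw [e2]
      have p1 := pd_le (g j) i y
      generalize pd i (F j) y = a at *
      generalize pd i (g j) y = b at *
      generalize ‖fderiv ℝ (g j) y‖ = d at *
      have p2 := sq_nonneg (a - b)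
      linarith

theorem morrey_neumann_aux (n : ℕ) (hn : 4 ≤ n) (q : ℝ) (hq : 1 < q) :
    ∃ C > 0, ∀ (u f : EuclideanSpace ℝ (Fin n) → ℝ)
      (g : Fin n → EuclideanSpace ℝ (Fin n) → ℝ),
      ContDiff ℝ (⊤ : ℕ∞) u → ContDiff ℝ (⊤ : ℕ∞) f → (∀ β, ContDiff ℝ (⊤ : ℕ∞) (g β)) →
      (∀ x ∈ openUnitCube n, lapl n u x = f x) →
      (∀ x ∈ unitCube n, ∀ β, (x β = 0 ∨ x β = 1) →
        fderiv ℝ u x (stdVec n β) = g β x) →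
      (∫ x in unitCube n, u x) = 0 →
      morreySobolev2 n q (unitCube n) u ≤
        C * morreyNorm n q 2 (unitCube n) f +
        C * (morreyNorm n q 2 (unitCube n) (fun x => Real.sqrt (∑ β, (g β x)^2)) +
             morreyNorm n q 2 (unitCube n)
               (fun x => Real.sqrt (∑ β, ‖fderiv ℝ (g β) x‖^2))) := by
  have hn0 : 0 < n := by omega
  have hq0 : 0 < q := by linarith
  obtain ⟨C, hC, H⟩ := final_thm n hn0 q hq0
  refine ⟨3 * √C + 1, by positivity, ?_⟩
  intro u f g hu hf hg hlap hbc hmean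
  have hu2 : ContDiff ℝ 2 u := by exact_mod_cast contDiff_infty.1 hu 2
  have hg1 : ∀ b, ContDiff ℝ 1 (g b) := fun b => (hg b).of_le (by exact_mod_cast (le_top : (1:ℕ∞) ≤ ⊤))
  have cdg : ∀ b, Continuous (fderiv ℝ (g b)) := fun b => (hg1 b).continuous_fderiv one_ne_zero
  have cg : ∀ b, Continuous (g b) := fun b => (hg1 b).continuous
  have m1 := N1 hn0 hq0 hf.continuous
  have m2 := N1 (q := q) hn0 hq0 (h := fun x => Real.sqrt (∑ β, (g β x)^2)) (by fun_prop)
  have m3 := N1 (q := q) hn0 hq0 (h := fun x => Real.sqrt (∑ β, ‖fderiv ℝ (g β) x‖^2)) (by fun_prop)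
  have n1 := N0 (n := n) (q := q) (h := f)
  have n2 := N0 (n := n) (q := q) (h := fun x => Real.sqrt (∑ β, (g β x)^2))
  have n3 := N0 (n := n) (q := q) (h := fun x => Real.sqrt (∑ β, ‖fderiv ℝ (g β) x‖^2))
  set A1 := morreyNorm n q 2 (unitCube n) f
  set A2 := morreyNorm n q 2 (unitCube n) (fun x => Real.sqrt (∑ β, (g β x)^2))
  set A3 := morreyNorm n q 2 (unitCube n) (fun x => Real.sqrt (∑ β, ‖fderiv ℝ (g β) x‖^2))
  have s2 : ∀ x, √(∑ β, (g β x)^2) ^ 2 = ∑ β, (g β x)^2 := fun x => Real.sq_sqrt (by positivity)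
  have s3 : ∀ x, √(∑ β, ‖fderiv ℝ (g β) x‖^2) ^ 2 = ∑ β, ‖fderiv ℝ (g β) x‖^2 := fun x => Real.sq_sqrt (by positivity)
  simp only [s2] at m2
  simp only [s3] at m3
  have mono : ∀ {h : EE n → ℝ} {A B : ℝ}, Mo (n - 2 * n / q) h A → A ≤ B → Mo (n - 2 * n / q) h B := by
    intro h A B hm hAB x r hr hr1
    exact (hm x r hr hr1).trans (by gcongr)
  set N := A1 + A2 + A3 with hN
  have hN0 : 0 ≤ N := by positivity
  obtain ⟨r1, r2, r3⟩ := H u f g hu2 hf.continuous hg1 hlap hbc hmean N hN0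
    (mono m1 (by gcongr; linarith)) (mono m2 (by gcongr; linarith)) (mono m3 (by gcongr; linarith))
  have e : C * N ^ 2 = (√C * N) ^ 2 := by rw [mul_pow, Real.sq_sqrt hC]
  rw [e] at r1 r2 r3
  have hA : 0 ≤ √C * N := by positivity
  have q1 := N2 hA r1
  have q2 := N2 hA r2
  have q3 := N2 hA r3
  unfold morreySobolev2
  have : (3 * √C + 1) * A1 + (3 * √C + 1) * (A2 + A3) = 3 * (√C * N) + N := by rw [hN]; ring
  rw [this]
  linarith

end

/-- Neumann problem regularity in Morrey spaces on the unit cube. -/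
theorem morrey_neumann_regularity (n : ℕ) (hn : 4 ≤ n) (q : ℝ) (hq : 1 < q) :
    ∃ C > 0, ∀ (u f : EuclideanSpace ℝ (Fin n) → ℝ)
      (g : Fin n → EuclideanSpace ℝ (Fin n) → ℝ),
      ContDiff ℝ (⊤ : ℕ∞) u → ContDiff ℝ (⊤ : ℕ∞) f → (∀ β, ContDiff ℝ (⊤ : ℕ∞) (g β)) →
      -- Δu = f on the open cube
      (∀ x ∈ openUnitCube n, lapl n u x = f x) →
      -- Neumann boundary condition n^β ∂_β u = n^β g_β on the faces
      (∀ x ∈ unitCube n, ∀ β, (x β = 0 ∨ x β = 1) →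
        fderiv ℝ u x (stdVec n β) = g β x) →
      -- normalization
      (∫ x in unitCube n, u x) = 0 →
      morreySobolev2 n q (unitCube n) u ≤
        C * morreyNorm n q 2 (unitCube n) f +
        C * (morreyNorm n q 2 (unitCube n) (fun x => Real.sqrt (∑ β, (g β x)^2)) +
             morreyNorm n q 2 (unitCube n)
               (fun x => Real.sqrt (∑ β, ‖fderiv ℝ (g β) x‖^2))) := by
  exact morrey_neumann_aux n hn q hq
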